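/- Schur–Weyl reciprocity (first half): the centralizer in End_K(V^{⊗r}) of the subalgebra ℬ_q equals the subalgebra 𝒜_q; that is, { X ∈ End_K(V^{⊗r}) : XY = YX for all Y ∈ ℬ_q } = 𝒜_q. -/

import Mathlib

set_option synthInstance.maxHeartbeats 1000000
set_option maxHeartbeats 1000000

open scoped BigOperators Kronecker

section CommonDefs

variable {R : Type*} [CommRing R]

/-- ℤ₂-degree of the basis vector `v_{k+1}` (0-based index `k`): `0` if `k < m`, else `1`. -/
def deg (m : ℕ) {N : ℕ} (k : Fin N) : ℕ := if (k : ℕ) < m then 0 else 1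

/-- The sign `(−1)^{|v_k||v_l|}`. -/
def sgn (R : Type*) [CommRing R] (m : ℕ) {N : ℕ} (k l : Fin N) : R :=
  (-1 : R) ^ (deg m k * deg m l)

/-- Entries (row = input vector) of the operator `T` on `V ⊗ V`, where `x` plays the
role of `q` and `xinv` that of `q⁻¹`:  `T(v_k ⊗ v_k) = q·v_k ⊗ v_k` if `k ≤ m`,
`T(v_k ⊗ v_k) = −q⁻¹·v_k ⊗ v_k` if `k > m`,
`T(v_k ⊗ v_l) = (−1)^{|v_k||v_l|} v_l ⊗ v_k + (q−q⁻¹) v_k ⊗ v_l` if `k < l`, and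
`T(v_k ⊗ v_l) = (−1)^{|v_k||v_l|} v_l ⊗ v_k` if `k > l`. -/
def Tent (x xinv : R) (m : ℕ) {N : ℕ} (p p' : Fin N × Fin N) : R :=
  if p.1 = p.2 then (if (p.1 : ℕ) < m then x else -xinv) * (if p' = p then 1 else 0)
  else if (p.1 : ℕ) < (p.2 : ℕ) then
    sgn R m p.1 p.2 * (if p' = (p.2, p.1) then 1 else 0)
      + (x - xinv) * (if p' = p then 1 else 0)
  else sgn R m p.1 p.2 * (if p' = (p.2, p.1) then 1 else 0)

/-- Entries of the signed swap `P(v_k ⊗ v_l) = (−1)^{|v_k||v_l|} v_l ⊗ v_k`. -/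
def Pent (R : Type*) [CommRing R] (m : ℕ) {N : ℕ} (p p' : Fin N × Fin N) : R :=
  sgn R m p.1 p.2 * (if p' = (p.2, p.1) then 1 else 0)

/-- The operator `Id^{⊗ i} ⊗ E ⊗ Id^{⊗ (r−i−2)}` on `V^{⊗ r}` obtained from a two-site
operator `E` acting on the (0-based) tensor positions `i` and `i+1`. -/
def twoSiteOp {N : ℕ} (E : Fin N × Fin N → Fin N × Fin N → R) (r i : ℕ) (h : i + 1 < r) :
    Matrix (Fin r → Fin N) (Fin r → Fin N) R := fun a b =>
  E (a ⟨i, Nat.lt_of_succ_lt h⟩, a ⟨i + 1, h⟩) (b ⟨i, Nat.lt_of_succ_lt h⟩, b ⟨i + 1, h⟩) *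
    ∏ j ∈ Finset.univ \ ({⟨i, Nat.lt_of_succ_lt h⟩, ⟨i + 1, h⟩} : Finset (Fin r)),
      (if a j = b j then (1 : R) else 0)

/-- The Hecke operator `T_{i+1} = Id^{⊗ i} ⊗ T ⊗ Id^{⊗ (r−i−2)}` on `V^{⊗ r}`
(here `i` is the 0-based position of the first tensor factor it acts on). -/
def heckeOp (x xinv : R) (m : ℕ) {N : ℕ} (r i : ℕ) (h : i + 1 < r) :
    Matrix (Fin r → Fin N) (Fin r → Fin N) R :=
  twoSiteOp (Tent x xinv m) r i h

/-- The signed swap operator `P_{i+1} = Id^{⊗ i} ⊗ P ⊗ Id^{⊗ (r−i−2)}` on `V^{⊗ r}`. -/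
def swapOp (R : Type*) [CommRing R] (m : ℕ) {N : ℕ} (r i : ℕ) (h : i + 1 < r) :
    Matrix (Fin r → Fin N) (Fin r → Fin N) R :=
  twoSiteOp (Pent R m) r i h

/-- The parity operator `S v_j = (−1)^{|v_j|} v_j`. -/
def Smat (R : Type*) [CommRing R] (m : ℕ) {N : ℕ} : Matrix (Fin N) (Fin N) R :=
  fun a b => if a = b then (-1 : R) ^ deg m a else 0

/-- The diagonal operator `Q_b v_j = q^{δ_{bj}} v_j` (`x` playing the role of `q`, or of
`q⁻¹` for the inverse operator). -/
def Qmat (x : R) {N : ℕ} (b0 : Fin N) : Matrix (Fin N) (Fin N) R :=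
  fun a b => if a = b then (if a = b0 then x else 1) else 0

/-- `E_k v_{k+1} = v_k`, `E_k v_j = 0` otherwise (0-based `k`; row = input). -/
def Emat (R : Type*) [CommRing R] {N : ℕ} (k : ℕ) : Matrix (Fin N) (Fin N) R :=
  fun a b => if (a : ℕ) = k + 1 ∧ (b : ℕ) = k then 1 else 0

/-- `F_k v_k = v_{k+1}`, `F_k v_j = 0` otherwise (0-based `k`; row = input). -/
def Fmat (R : Type*) [CommRing R] {N : ℕ} (k : ℕ) : Matrix (Fin N) (Fin N) R :=
  fun a b => if (a : ℕ) = k ∧ (b : ℕ) = k + 1 then 1 else 0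

/-- The diagonal operator `D_k v_j = q^{s(k)δ_{kj} − s(k+1)δ_{k+1,j}} v_j`
(0-based `k`, so `s(k) = 1` iff `k < m`, and `s(k) = −1` otherwise). -/
def Dmat (x xinv : R) (m : ℕ) {N : ℕ} (k : ℕ) : Matrix (Fin N) (Fin N) R :=
  fun a b => if a = b then
    (if (a : ℕ) = k then (if k < m then x else xinv)
     else if (a : ℕ) = k + 1 then (if k + 1 < m then xinv else x) else 1)
  else 0

/-- The inverse `D_k⁻¹` of `Dmat` (obtained by exchanging `q` and `q⁻¹`). -/
def Dinvmat (x xinv : R) (m : ℕ) {N : ℕ} (k : ℕ) : Matrix (Fin N) (Fin N) R :=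
  Dmat xinv x m k

/-- `S^{p(k)}`, where `p(k) = 1` if the 0-based `k` satisfies `k + 1 = m` (the odd simple
root) and `p(k) = 0` otherwise. -/
def SPmat (R : Type*) [CommRing R] (m : ℕ) {N : ℕ} (k : ℕ) : Matrix (Fin N) (Fin N) R :=
  if k + 1 = m then Smat R m else 1

/-- Kronecker (tensor) product of `r` one-site operators, as a matrix on `V^{⊗ r}`. -/
def kron {N r : ℕ} (M : Fin r → Matrix (Fin N) (Fin N) R) :
    Matrix (Fin r → Fin N) (Fin r → Fin N) R :=
  fun a b => ∏ j, M j (a j) (b j)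

/-- `ρ_r(σ) = S^{⊗ r}`. -/
def rhoSigma (R : Type*) [CommRing R] (m : ℕ) {N : ℕ} (r : ℕ) :
    Matrix (Fin r → Fin N) (Fin r → Fin N) R :=
  kron fun _ => Smat R m

/-- `ρ_r(q^{δ_b}) = Q_b^{⊗ r}` (and its inverse, substituting `q⁻¹` for `x`). -/
def rhoQ (x : R) {N : ℕ} (r : ℕ) (b0 : Fin N) :
    Matrix (Fin r → Fin N) (Fin r → Fin N) R :=
  kron fun _ => Qmat x b0

/-- `ρ_r(e_k) = Σ_{j=1}^{r} (S^{p(k)})^{⊗(j−1)} ⊗ E_k ⊗ (D_k^{−1})^{⊗(r−j)}`. -/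
def rhoE (x xinv : R) (m : ℕ) {N : ℕ} (r : ℕ) (k : ℕ) :
    Matrix (Fin r → Fin N) (Fin r → Fin N) R :=
  ∑ p : Fin r, kron fun j =>
    if j < p then SPmat R m k else if j = p then Emat R k else Dinvmat x xinv m k

/-- `ρ_r(f_k) = Σ_{j=1}^{r} (S^{p(k)}D_k)^{⊗(j−1)} ⊗ F_k ⊗ Id^{⊗(r−j)}`. -/
def rhoF (x xinv : R) (m : ℕ) {N : ℕ} (r : ℕ) (k : ℕ) :
    Matrix (Fin r → Fin N) (Fin r → Fin N) R :=
  ∑ p : Fin r, kron fun j =>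
    if j < p then SPmat R m k * Dmat x xinv m k else if j = p then Fmat R k else 1

/-- The generators `T_1, …, T_{r−1}` of the image of the sign `q`-permutation
representation of the Iwahori–Hecke algebra on `V^{⊗ r}`. -/
def heckeGens (x xinv : R) (m : ℕ) {N : ℕ} (r : ℕ) :
    Set (Matrix (Fin r → Fin N) (Fin r → Fin N) R) :=
  {M | ∃ (i : ℕ) (h : i + 1 < r), M = heckeOp x xinv m r i h}

/-- The signed-swap generators `P_1, …, P_{r−1}` (the `q → 1` specialization). -/
def swapGens (R : Type*) [CommRing R] (m : ℕ) {N : ℕ} (r : ℕ) :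
    Set (Matrix (Fin r → Fin N) (Fin r → Fin N) R) :=
  {M | ∃ (i : ℕ) (h : i + 1 < r), M = swapOp R m r i h}

/-- The generators `ρ_r(σ)`, `ρ_r(q^{± δ_b})` (`1 ≤ b ≤ N`), `ρ_r(e_k)`, `ρ_r(f_k)`
(`1 ≤ k ≤ N−1`) of the image of the vector representation of `U_q^σ(gl(m,n))`. -/
def quantumGens (x xinv : R) (m : ℕ) {N : ℕ} (r : ℕ) :
    Set (Matrix (Fin r → Fin N) (Fin r → Fin N) R) :=
  {rhoSigma R m r} ∪ (Set.range fun b : Fin N => rhoQ x r b)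
    ∪ (Set.range fun b : Fin N => rhoQ xinv r b)
    ∪ (Set.range fun k : Fin (N - 1) => rhoE x xinv m r (k : ℕ))
    ∪ (Set.range fun k : Fin (N - 1) => rhoF x xinv m r (k : ℕ))

end CommonDefs

/-- The base field `K = ℚ(q)` of rational functions over `ℚ`. -/
abbrev 𝕂 : Type := RatFunc ℚ

/-- The indeterminate `q` of `K = ℚ(q)`. -/
noncomputable def q : 𝕂 := RatFunc.X

/-- `𝒜_q`: the image of the sign `q`-permutation representation of the Iwahori–Hecke
algebra `H_{K,r}(q)`, i.e. the `K`-subalgebra of `End_K(V^{⊗ r})` generated by the Hecke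
operators `T_1, …, T_{r−1}`. -/
noncomputable def Aq (m n r : ℕ) :
    Subalgebra 𝕂 (Module.End 𝕂 ((Fin r → Fin (m + n)) → 𝕂)) :=
  Algebra.adjoin 𝕂 (Matrix.vecMulLinear '' heckeGens q q⁻¹ m (N := m + n) r)

/-- `ℬ_q`: the image of the vector representation of `U_q^σ(gl(m,n))`, i.e. the
`K`-subalgebra of `End_K(V^{⊗ r})` generated by `ρ_r(σ)`, `ρ_r(q^{±δ_b})`
(`1 ≤ b ≤ m+n`), `ρ_r(e_k)` and `ρ_r(f_k)` (`1 ≤ k ≤ m+n−1`). -/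
noncomputable def Bq (m n r : ℕ) :
    Subalgebra 𝕂 (Module.End 𝕂 ((Fin r → Fin (m + n)) → 𝕂)) :=
  Algebra.adjoin 𝕂 (Matrix.vecMulLinear '' quantumGens q q⁻¹ m (N := m + n) r)

section TwoSite

variable {R : Type*} [CommRing R] {N r : ℕ}

lemma kron_mul (M M' : Fin r → Matrix (Fin N) (Fin N) R) :
    kron M * kron M' = kron fun j => M j * M' j := by
  ext a b
  simp only [kron, Matrix.mul_apply, ← Finset.prod_mul_distrib]
  rw [Finset.prod_univ_sum, Fintype.piFinset_univ]

lemma kron_one : kron (fun _ : Fin r => (1 : Matrix (Fin N) (Fin N) R)) = 1 := by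
  ext a b
  simp only [kron, Matrix.one_apply, Finset.prod_ite_zero, Finset.prod_const_one, funext_iff,
    Finset.mem_univ, true_imp_iff]

/-- The operator acting by the two-site operator `E` on the sites `s`, `t` and by `M j` on every
other site `j`. -/
def siteMix (s t : Fin r) (E : Matrix (Fin N × Fin N) (Fin N × Fin N) R)
    (M : Fin r → Matrix (Fin N) (Fin N) R) : Matrix (Fin r → Fin N) (Fin r → Fin N) R :=
  fun a b => E (a s, a t) (b s, b t) *
    ∏ j ∈ Finset.univ \ ({s, t} : Finset (Fin r)), M j (a j) (b j)

lemma kron_eq_siteMix {s t : Fin r} (h : s ≠ t) (M : Fin r → Matrix (Fin N) (Fin N) R) :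
    kron M = siteMix s t (M s ⊗ₖ M t) M := by
  ext a b
  simp only [kron, siteMix, Matrix.kroneckerMap_apply]
  rw [← Finset.prod_sdiff (Finset.subset_univ {s, t}), Finset.prod_pair h, mul_comm]

lemma siteMix_congr {s t : Fin r} (E : Matrix (Fin N × Fin N) (Fin N × Fin N) R)
    {M M' : Fin r → Matrix (Fin N) (Fin N) R} (h : ∀ j, j ≠ s → j ≠ t → M j = M' j) :
    siteMix s t E M = siteMix s t E M' := by
  ext a b
  simp only [siteMix]
  congr 1
  refine Finset.prod_congr rfl fun j hj => ?_
  simp only [Finset.mem_sdiff, Finset.mem_univ, Finset.mem_insert, Finset.mem_singleton,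
    true_and, not_or] at hj
  rw [h j hj.1 hj.2]

lemma siteMix_add {s t : Fin r} (E E' : Matrix (Fin N × Fin N) (Fin N × Fin N) R)
    (M : Fin r → Matrix (Fin N) (Fin N) R) :
    siteMix s t (E + E') M = siteMix s t E M + siteMix s t E' M := by
  ext a b
  simp [siteMix, add_mul]

lemma siteMix_zero {s t : Fin r} (M : Fin r → Matrix (Fin N) (Fin N) R) :
    siteMix s t 0 M = 0 := by
  ext a b
  simp [siteMix]

lemma siteMix_smul {s t : Fin r} (c : R) (E : Matrix (Fin N × Fin N) (Fin N × Fin N) R)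
    (M : Fin r → Matrix (Fin N) (Fin N) R) :
    siteMix s t (c • E) M = c • siteMix s t E M := by
  ext a b
  simp [siteMix, mul_assoc]

lemma siteMix_kronecker {s t : Fin r} (h : s ≠ t) (A B : Matrix (Fin N) (Fin N) R)
    (M : Fin r → Matrix (Fin N) (Fin N) R) :
    siteMix s t (A ⊗ₖ B) M = kron (Function.update (Function.update M s A) t B) := by
  rw [kron_eq_siteMix h]
  simp only [Function.update_self, Function.update_of_ne h]
  refine siteMix_congr _ fun j hs ht => ?_
  simp [hs, ht]

lemma siteMix_mul {s t : Fin r} (h : s ≠ t)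
    (E E' : Matrix (Fin N × Fin N) (Fin N × Fin N) R)
    (M M' : Fin r → Matrix (Fin N) (Fin N) R) :
    siteMix s t E M * siteMix s t E' M' = siteMix s t (E * E') fun j => M j * M' j := by
  have hsingle : ∀ (p p' : Fin N × Fin N) (c : R), Matrix.single p p' c =
      c • (Matrix.single p.1 p'.1 (1 : R) ⊗ₖ Matrix.single p.2 p'.2 (1 : R)) := by
    intro p p' c
    rw [Matrix.single_kronecker_single]
    simp
  induction E using Matrix.induction_on' with
  | h_zero => simp [siteMix_zero]
  | h_add E₁ E₂ h₁ h₂ => simp only [siteMix_add, add_mul, h₁, h₂]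
  | h_std_basis p p' c =>
    induction E' using Matrix.induction_on' with
    | h_zero => simp [siteMix_zero]
    | h_add E₁ E₂ h₁ h₂ => simp only [siteMix_add, mul_add, h₁, h₂]
    | h_std_basis u u' d =>
      rw [hsingle, hsingle u, smul_mul_smul_comm, siteMix_smul, siteMix_smul, siteMix_smul,
        smul_mul_smul_comm, ← Matrix.mul_kronecker_mul, siteMix_kronecker h, siteMix_kronecker h,
        siteMix_kronecker h, kron_mul]
      congr 2
      ext1 j
      by_cases hjt : j = t
      · subst hjt; simp
      · by_cases hjs : j = s
        · subst hjs; simp [h]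
        · simp [hjs, hjt]

lemma twoSiteOp_eq_siteMix (E : Fin N × Fin N → Fin N × Fin N → R) (i : ℕ) (h : i + 1 < r) :
    twoSiteOp E r i h =
      siteMix ⟨i, Nat.lt_of_succ_lt h⟩ ⟨i + 1, h⟩ (Matrix.of E) fun _ => 1 := by
  ext a b
  simp [twoSiteOp, siteMix, Matrix.one_apply]

lemma commute_twoSiteOp_siteMix {E : Fin N × Fin N → Fin N × Fin N → R} {i : ℕ} {h : i + 1 < r}
    {F : Matrix (Fin N × Fin N) (Fin N × Fin N) R} (hF : Commute (Matrix.of E) F)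
    (M : Fin r → Matrix (Fin N) (Fin N) R) :
    Commute (twoSiteOp E r i h)
      (siteMix ⟨i, Nat.lt_of_succ_lt h⟩ ⟨i + 1, h⟩ F M) := by
  have hne : (⟨i, Nat.lt_of_succ_lt h⟩ : Fin r) ≠ ⟨i + 1, h⟩ := by simp
  rw [Commute, SemiconjBy, twoSiteOp_eq_siteMix, siteMix_mul hne, siteMix_mul hne, hF.eq]
  simp

lemma commute_twoSiteOp_kron_const {E : Fin N × Fin N → Fin N × Fin N → R} {i : ℕ}
    {h : i + 1 < r} {A : Matrix (Fin N) (Fin N) R} (hA : Commute (Matrix.of E) (A ⊗ₖ A)) :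
    Commute (twoSiteOp E r i h) (kron fun _ => A) := by
  rw [kron_eq_siteMix (s := ⟨i, Nat.lt_of_succ_lt h⟩) (t := ⟨i + 1, h⟩) (by simp)]
  exact commute_twoSiteOp_siteMix hA _

lemma commute_twoSiteOp_coproduct {E : Fin N × Fin N → Fin N × Fin N → R} {i : ℕ}
    {h : i + 1 < r} {A B X : Matrix (Fin N) (Fin N) R} (hA : Commute (Matrix.of E) (A ⊗ₖ A))
    (hB : Commute (Matrix.of E) (B ⊗ₖ B))
    (hX : Commute (Matrix.of E) (X ⊗ₖ B + A ⊗ₖ X)) :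
    Commute (twoSiteOp E r i h)
      (∑ p : Fin r, kron fun j => if j < p then A else if j = p then X else B) := by
  set s : Fin r := ⟨i, Nat.lt_of_succ_lt h⟩ with hs
  set t : Fin r := ⟨i + 1, h⟩ with ht
  have hst : s ≠ t := by simp [hs, ht]
  rw [← Finset.sum_sdiff (Finset.subset_univ {s, t}), Finset.sum_pair hst]
  refine Commute.add_right (Commute.sum_right _ _ _ fun p hp => ?_) ?_
  · simp only [Finset.mem_sdiff, Finset.mem_univ, Finset.mem_insert, Finset.mem_singleton,
      true_and, not_or] at hp
    rw [kron_eq_siteMix hst]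
    refine commute_twoSiteOp_siteMix ?_ _
    have h1 : (p : ℕ) ≠ i := fun e => hp.1 (Fin.ext e)
    have h2 : (p : ℕ) ≠ i + 1 := fun e => hp.2 (Fin.ext e)
    rw [if_neg (Ne.symm hp.1), if_neg (Ne.symm hp.2)]
    by_cases hlt : s < p
    · have : t < p := by simp only [Fin.lt_def, hs, ht] at hlt ⊢; omega
      simpa [hlt, this] using hA
    · have : ¬ t < p := by simp only [Fin.lt_def, hs, ht] at hlt ⊢; omega
      simpa [hlt, this] using hB
  · have hlt : s < t := by simp [Fin.lt_def, hs, ht]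
    rw [kron_eq_siteMix hst, kron_eq_siteMix hst (fun j => if j < t then A else _),
      siteMix_congr (M' := fun j => if j < s then A else if j = s then X else B)
        (M := fun j => if j < t then A else if j = t then X else B), ← siteMix_add]
    · refine commute_twoSiteOp_siteMix ?_ _
      simpa [hlt, hlt.not_gt, hst.symm] using hX
    · intro j hjs hjt
      have h1 : (j : ℕ) ≠ i := fun e => hjs (Fin.ext e)
      have h2 : (j : ℕ) ≠ i + 1 := fun e => hjt (Fin.ext e)
      have : j < s ↔ j < t := by simp only [Fin.lt_def, hs, ht]; omega
      simp [hjs, hjt, this]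

end TwoSite

section Hecke

variable {R : Type*} [CommRing R] {N : ℕ} (x xinv : R) (m : ℕ)

/-- The diagonal coefficient of `Tent`. -/
def hdiag (p : Fin N × Fin N) : R :=
  if p.1 = p.2 then (if (p.1 : ℕ) < m then x else -xinv)
  else if (p.1 : ℕ) < (p.2 : ℕ) then x - xinv else 0

/-- The coefficient of the flip in `Tent`. -/
def hswap (R : Type*) [CommRing R] (m : ℕ) (p : Fin N × Fin N) : R :=
  if p.1 = p.2 then 0 else sgn R m p.1 p.2

lemma Tent_eq (p p' : Fin N × Fin N) :
    Tent x xinv m p p' = hdiag x xinv m p * (if p' = p then 1 else 0)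
      + hswap R m p * (if p' = p.swap then 1 else 0) := by
  obtain ⟨a, b⟩ := p
  by_cases h : a = b
  · simp [Tent, hdiag, hswap, h]
  · by_cases h' : (a : ℕ) < b <;> simp [Tent, hdiag, hswap, h, h', add_comm]

lemma hswap_swap (p : Fin N × Fin N) : hswap R m p.swap = hswap R m p := by
  simp only [hswap, sgn, Prod.fst_swap, Prod.snd_swap, eq_comm (a := p.2), mul_comm (deg m p.2)]

lemma Tent_mul_apply (M : Matrix (Fin N × Fin N) (Fin N × Fin N) R) (p p' : Fin N × Fin N) :
    ((Matrix.of (Tent x xinv m) * M : Matrix (Fin N × Fin N) (Fin N × Fin N) R)) p p' =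
      hdiag x xinv m p * M p p' + hswap R m p * M p.swap p' := by
  simp [Matrix.mul_apply, Tent_eq, add_mul, Finset.sum_add_distrib]

lemma mul_Tent_apply (M : Matrix (Fin N × Fin N) (Fin N × Fin N) R) (p p' : Fin N × Fin N) :
    ((M * Matrix.of (Tent x xinv m) : Matrix (Fin N × Fin N) (Fin N × Fin N) R)) p p' =
      M p p' * hdiag x xinv m p' + M p p'.swap * hswap R m p' := by
  have h : ∀ u : Fin N × Fin N, (p' = u.swap) = (u = p'.swap) := fun u =>
    propext ⟨fun e => by simp [e], fun e => by simp [e]⟩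
  simp [Matrix.mul_apply, Tent_eq, mul_add, Finset.sum_add_distrib, h, hswap_swap]

lemma commute_Tent_diagonal (f : Fin N → R) :
    Commute (Matrix.of (Tent x xinv m)) (Matrix.diagonal f ⊗ₖ Matrix.diagonal f) := by
  ext ⟨a, b⟩ ⟨c, d⟩
  rw [Tent_mul_apply, mul_Tent_apply, Matrix.diagonal_kronecker_diagonal]
  simp only [Matrix.diagonal_apply, Prod.swap, Prod.mk.injEq]
  by_cases h1 : a = c ∧ b = d
  · obtain ⟨rfl, rfl⟩ := h1
    by_cases hab : a = b
    · subst hab; simp; ring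
    · simp [hab, Ne.symm hab]; ring
  · by_cases h2 : a = d ∧ b = c
    · obtain ⟨rfl, rfl⟩ := h2
      have hab : a ≠ b := fun e => h1 ⟨e, e.symm⟩
      have := hswap_swap (R := R) m (a, b)
      simp only [Prod.swap] at this
      simp [hab, Ne.symm hab, this]; ring
    · have h2' : ¬ (b = c ∧ a = d) := fun e => h2 e.symm
      simp [h1, h2, h2']

/-- The vector of diagonal entries of `S^{p(k)}`. -/
def spdiag (R : Type*) [CommRing R] (m : ℕ) {N : ℕ} (k : ℕ) (a : Fin N) : R :=
  if k + 1 = m then (if (a : ℕ) < m then 1 else -1) else 1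

/-- The vector of diagonal entries of `D_k`. -/
def ddiag (x xinv : R) (m : ℕ) {N : ℕ} (k : ℕ) (a : Fin N) : R :=
  if (a : ℕ) = k then (if k < m then x else xinv)
     else if (a : ℕ) = k + 1 then (if k + 1 < m then xinv else x) else 1

lemma Smat_eq : Smat R m (N := N) = Matrix.diagonal fun a => (-1) ^ deg m a := by
  ext a b; simp [Smat, Matrix.diagonal_apply]

lemma SPmat_eq (k : ℕ) : SPmat R m (N := N) k = Matrix.diagonal (spdiag R m k) := by
  unfold SPmat spdiag
  split_ifs
  · rw [Smat_eq]; congr 1; ext a; unfold deg; split_ifs <;> simp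
  · simp

lemma Dmat_eq (k : ℕ) : Dmat x xinv m (N := N) k = Matrix.diagonal (ddiag x xinv m k) := by
  ext a b; simp [Dmat, ddiag, Matrix.diagonal_apply]

lemma Qmat_eq (b : Fin N) : Qmat x b = Matrix.diagonal fun a => if a = b then x else 1 := by
  ext a b; simp [Qmat, Matrix.diagonal_apply]

lemma commute_Tent_E (h : x * xinv = 1) (k : ℕ) :
    Commute (Matrix.of (Tent x xinv m (N := N)))
      (Emat R k ⊗ₖ Dinvmat x xinv m k + SPmat R m k ⊗ₖ Emat R k) := by
  rw [Dinvmat, Dmat_eq, SPmat_eq]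
  ext ⟨a, b⟩ ⟨c, d⟩
  rw [Tent_mul_apply, mul_Tent_apply]
  simp only [Matrix.add_apply, Matrix.kroneckerMap_apply, Matrix.diagonal_apply, Prod.swap, Emat,
    hdiag, hswap, sgn, deg, spdiag, ddiag, Fin.ext_iff]
  obtain ⟨a, ha⟩ := a
  obtain ⟨b, hb⟩ := b
  obtain ⟨c, hc⟩ := c
  obtain ⟨d, hd⟩ := d
  simp only
  by_cases h1 : a = k
  · subst h1
    by_cases h2 : b = a
    · subst h2
      simp
    · by_cases h3 : b = a + 1
      · subst h3
        simp
        grind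
      · simp [h2, h3, Ne.symm h2]
  · by_cases h1' : a = k + 1
    · subst h1'
      by_cases h2 : b = k
      · subst h2
        simp
        grind
      · by_cases h3 : b = k + 1
        · subst h3
          simp
          grind
        · simp [h2, h3, Ne.symm h3]
          grind
    · by_cases h2 : b = k
      · subst h2
        simp [h1, h1']
      · by_cases h3 : b = k + 1
        · subst h3
          simp [h1, h1']
          grind
        · simp [h1, h1', h2, h3]

lemma commute_Tent_F (h : x * xinv = 1) (k : ℕ) :
    Commute (Matrix.of (Tent x xinv m (N := N)))
      (Fmat R k ⊗ₖ 1 + (SPmat R m k * Dmat x xinv m k) ⊗ₖ Fmat R k) := by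
  rw [Dmat_eq, SPmat_eq, Matrix.diagonal_mul_diagonal]
  ext ⟨a, b⟩ ⟨c, d⟩
  rw [Tent_mul_apply, mul_Tent_apply]
  simp only [Matrix.add_apply, Matrix.kroneckerMap_apply, Matrix.diagonal_apply,
    Matrix.one_apply, Prod.swap, Fmat, hdiag, hswap, sgn, deg, spdiag, ddiag, Fin.ext_iff]
  obtain ⟨a, ha⟩ := a
  obtain ⟨b, hb⟩ := b
  obtain ⟨c, hc⟩ := c
  obtain ⟨d, hd⟩ := d
  simp only
  by_cases h1 : a = k
  · subst h1
    by_cases h2 : b = a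
    · subst h2
      simp
      grind
    · by_cases h3 : b = a + 1
      · subst h3
        simp
        grind
      · simp [h2, h3, Ne.symm h2]
        grind
  · by_cases h1' : a = k + 1
    · subst h1'
      by_cases h2 : b = k
      · subst h2
        simp
        grind
      · by_cases h3 : b = k + 1
        · subst h3
          simp
        · simp [h2, h3, Ne.symm h3]
    · by_cases h2 : b = k
      · subst h2
        simp [h1, h1']
        grind
      · by_cases h3 : b = k + 1
        · subst h3
          simp [h1, h1']
        · simp [h1, h1', h2, h3]

end Hecke

section HeckeCentralizes

variable {R : Type*} [CommRing R] {N r : ℕ} {x xinv : R} {m : ℕ}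

lemma commute_heckeOp_of_mem_quantumGens (hx : x * xinv = 1) (i : ℕ) (h : i + 1 < r)
    {Y : Matrix (Fin r → Fin N) (Fin r → Fin N) R} (hY : Y ∈ quantumGens x xinv m r) :
    Commute (heckeOp x xinv m r i h) Y := by
  rcases hY with (((rfl | ⟨b, rfl⟩) | ⟨b, rfl⟩) | ⟨k, rfl⟩) | ⟨k, rfl⟩
  · refine commute_twoSiteOp_kron_const ?_
    rw [Smat_eq]
    exact commute_Tent_diagonal _ _ _ _
  · refine commute_twoSiteOp_kron_const ?_
    rw [Qmat_eq]
    exact commute_Tent_diagonal _ _ _ _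
  · refine commute_twoSiteOp_kron_const ?_
    rw [Qmat_eq]
    exact commute_Tent_diagonal _ _ _ _
  · refine commute_twoSiteOp_coproduct ?_ ?_ (commute_Tent_E _ _ _ hx _)
    · rw [SPmat_eq]
      exact commute_Tent_diagonal _ _ _ _
    · rw [Dinvmat, Dmat_eq]
      exact commute_Tent_diagonal _ _ _ _
  · refine commute_twoSiteOp_coproduct ?_ ?_ (commute_Tent_F _ _ _ hx _)
    · rw [SPmat_eq, Dmat_eq, Matrix.diagonal_mul_diagonal]
      exact commute_Tent_diagonal _ _ _ _
    · rw [← Matrix.diagonal_one]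
      exact commute_Tent_diagonal _ _ _ _

end HeckeCentralizes

section DoubleCentralizer

variable {I : Type*} [Fintype I] [DecidableEq I]

/-- A transpose-stable algebra of rational matrices acts semisimply. -/
lemma isSemisimpleModule_of_transpose_mem (A : Subalgebra ℚ (Module.End ℚ (I → ℚ)))
    (hA : ∀ M : Matrix I I ℚ, Matrix.toLin' M ∈ A → Matrix.toLin' M.transpose ∈ A) :
    IsSemisimpleModule A (I → ℚ) := by
  refine { exists_isCompl := fun U => ?_ }
  let B : LinearMap.BilinForm ℚ (I → ℚ) := dotProductBilin ℚ ℚ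
  have hrefl : B.IsRefl := fun u v huv => by
    simpa [B, dotProduct_comm] using huv
  let U₀ : Submodule ℚ (I → ℚ) := U.restrictScalars ℚ
  have hdisj : Disjoint U₀ (B.orthogonal U₀) := by
    rw [Submodule.disjoint_def]
    intro u hu hu'
    exact dotProduct_self_eq_zero.mp (hu' u hu)
  have hcompl := (LinearMap.BilinForm.isCompl_orthogonal_iff_disjoint hrefl).mpr hdisj
  let U' : Submodule A (I → ℚ) :=
    { (B.orthogonal U₀).toAddSubmonoid with
      smul_mem' := by
        rintro ⟨a, ha⟩ v hv u hu
        obtain ⟨M, rfl⟩ := Matrix.toLin'.surjective a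
        have h := hv _ (U.smul_mem ⟨_, hA M ha⟩ hu)
        simp only [B, dotProductBilin_apply_apply] at h ⊢
        rw [← h]
        change u ⬝ᵥ (M.mulVec v) = (M.transpose.mulVec u) ⬝ᵥ v
        rw [Matrix.dotProduct_mulVec, Matrix.mulVec_transpose] }
  refine ⟨U', ?_⟩
  constructor
  · rw [Submodule.disjoint_def]
    intro u hu hu'
    exact Submodule.disjoint_def.mp hdisj u hu hu'
  · rw [codisjoint_iff, Submodule.eq_top_iff']
    intro v
    have hv : v ∈ U₀ ⊔ B.orthogonal U₀ := by rw [hcompl.sup_eq_top]; trivial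
    obtain ⟨u, hu, w, hw, rfl⟩ := Submodule.mem_sup.mp hv
    exact Submodule.add_mem_sup hu hw

/-- The double centralizer property of transpose-stable algebras of rational matrices. -/
theorem mem_of_commute_centralizer (A : Subalgebra ℚ (Matrix I I ℚ))
    (hA : ∀ a ∈ A, a.transpose ∈ A) (X : Matrix I I ℚ)
    (hX : ∀ C, (∀ a ∈ A, Commute C a) → Commute X C) : X ∈ A := by
  let A' : Subalgebra ℚ (Module.End ℚ (I → ℚ)) := A.map (Matrix.toLinAlgEquiv').toAlgHom
  have hA' : ∀ M : Matrix I I ℚ, Matrix.toLin' M ∈ A' ↔ M ∈ A := by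
    intro M
    constructor
    · rintro ⟨M', hM', h⟩
      rwa [← Matrix.toLin'.injective h]
    · exact fun h => ⟨M, h, rfl⟩
  have := isSemisimpleModule_of_transpose_mem A' fun M hM => by
    rw [hA'] at hM ⊢
    exact hA M hM
  let f : Module.End (Module.End A' (I → ℚ)) (I → ℚ) :=
    { toFun := fun v => X.mulVec v
      map_add' := fun u v => Matrix.mulVec_add X u v
      map_smul' := fun φ v => by
        let C : Matrix I I ℚ := LinearMap.toMatrix' (φ.restrictScalars ℚ)
        have hC : ∀ v, C.mulVec v = φ v := fun v => by
          rw [← Matrix.toLin'_apply, Matrix.toLin'_toMatrix']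
          rfl
        have hcomm : Commute X C := hX C fun a ha => by
          apply Matrix.toLin'.injective
          refine LinearMap.ext fun v => ?_
          simp only [Matrix.toLin'_mul, LinearMap.comp_apply, Matrix.toLin'_apply, hC]
          exact φ.map_smul (⟨Matrix.toLin' a, (hA' a).mpr ha⟩ : A') v
        simp only [Module.End.smul_def, RingHom.id_apply]
        rw [← hC, ← hC, Matrix.mulVec_mulVec, Matrix.mulVec_mulVec, hcomm.eq] }
  obtain ⟨a, ha⟩ := jacobson_density (R := A') (M := I → ℚ) f
    (Finset.univ.image fun i => Pi.single i (1 : ℚ))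
  have hXa : Matrix.toLin' X = (a : Module.End ℚ (I → ℚ)) := by
    refine LinearMap.pi_ext' fun i => ?_
    ext1
    exact ha _ (Finset.mem_image_of_mem _ (Finset.mem_univ i))
  rw [← hA', hXa]
  exact a.2

end DoubleCentralizer

section JordanWigner

variable {N r : ℕ} (m : ℕ)

/-- `x` is homogeneous of degree `d` modulo 2. -/
def IsHomog (d : ℕ) (x : Matrix (Fin N) (Fin N) ℚ) : Prop :=
  x * Smat ℚ m = (-1 : ℚ) ^ d • (Smat ℚ m * x)

/-- The operator `x` of degree `d` placed at site `j`, with the sign operators to its left that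
the super tensor product prescribes. -/
def site (d : ℕ) (x : Matrix (Fin N) (Fin N) ℚ) (j : Fin r) :
    Matrix (Fin r → Fin N) (Fin r → Fin N) ℚ :=
  kron fun i => if i < j then Smat ℚ m ^ d else if i = j then x else 1

/-- The action of `x`, of degree `d`, on the tensor space by superderivations. -/
def siteSum (r d : ℕ) (x : Matrix (Fin N) (Fin N) ℚ) :
    Matrix (Fin r → Fin N) (Fin r → Fin N) ℚ :=
  ∑ j, site m d x j

lemma Smat_mul_self : Smat ℚ m (N := N) * Smat ℚ m = 1 := by
  rw [Smat_eq, Matrix.diagonal_mul_diagonal, ← Matrix.diagonal_one]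
  congr 1
  ext a
  simp [← mul_pow]

lemma Smat_pow_add_two_mul (d k : ℕ) : Smat ℚ m (N := N) ^ (d + 2 * k) = Smat ℚ m ^ d := by
  rw [pow_add, pow_mul, pow_two, Smat_mul_self, one_pow, mul_one]

lemma site_add_two_mul (d k : ℕ) (x : Matrix (Fin N) (Fin N) ℚ) (j : Fin r) :
    site m (d + 2 * k) x j = site m d x j := by
  simp only [site, Smat_pow_add_two_mul]

lemma site_apply (d : ℕ) (x : Matrix (Fin N) (Fin N) ℚ) (j : Fin r) (a b : Fin r → Fin N) :
    site m d x j a b = x (a j) (b j) *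
      ∏ i ∈ Finset.univ.erase j, (if i < j then Smat ℚ m ^ d else 1) (a i) (b i) := by
  simp only [site, kron]
  rw [← Finset.mul_prod_erase _ _ (Finset.mem_univ j)]
  congr 1
  · simp
  · refine Finset.prod_congr rfl fun i hi => ?_
    simp [Finset.ne_of_mem_erase hi]

/-- `siteSum` as a linear map. -/
def siteSumLin (r d : ℕ) :
    Matrix (Fin N) (Fin N) ℚ →ₗ[ℚ] Matrix (Fin r → Fin N) (Fin r → Fin N) ℚ where
  toFun x := siteSum m r d x
  map_add' x y := by
    ext a b
    simp [siteSum, Matrix.sum_apply, site_apply, add_mul, Finset.sum_add_distrib]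
  map_smul' c x := by
    ext a b
    simp [siteSum, Matrix.sum_apply, site_apply, mul_assoc, Finset.mul_sum]

lemma IsHomog.mul_Smat_pow {d : ℕ} {x : Matrix (Fin N) (Fin N) ℚ} (hx : IsHomog m d x) (e : ℕ) :
    x * Smat ℚ m ^ e = (-1 : ℚ) ^ (d * e) • (Smat ℚ m ^ e * x) := by
  induction e with
  | zero => simp
  | succ e ih =>
    rw [pow_succ, ← mul_assoc, ih, smul_mul_assoc, mul_assoc, hx, mul_smul_comm, smul_smul,
      ← mul_assoc, mul_add, mul_one, pow_add]

lemma IsHomog.mul {d e : ℕ} {x y : Matrix (Fin N) (Fin N) ℚ} (hx : IsHomog m d x)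
    (hy : IsHomog m e y) : IsHomog m (d + e) (x * y) := by
  unfold IsHomog at *
  rw [mul_assoc, hy, mul_smul_comm, ← mul_assoc, hx, smul_mul_assoc, smul_smul, mul_assoc, pow_add,
    mul_comm]

lemma IsHomog.apply {d : ℕ} {x : Matrix (Fin N) (Fin N) ℚ} (hx : IsHomog m d x) (a b : Fin N) :
    x a b * (-1) ^ deg m b = (-1) ^ d * ((-1) ^ deg m a * x a b) := by
  have h := congrFun (congrFun hx a) b
  rwa [Smat_eq, Matrix.mul_diagonal, Matrix.smul_apply, Matrix.diagonal_mul, smul_eq_mul] at h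

lemma isHomog_single (a b : Fin N) :
    IsHomog m (deg m a + deg m b) (Matrix.single a b (1 : ℚ)) := by
  ext i j
  rw [Smat_eq, Matrix.mul_diagonal, Matrix.smul_apply, Matrix.diagonal_mul, smul_eq_mul]
  by_cases h : a = i ∧ b = j
  · obtain ⟨rfl, rfl⟩ := h
    simp only [Matrix.single_apply_same, pow_add, one_mul, mul_one]
    rw [mul_right_comm, ← mul_pow]
    simp
  · simp [h]

lemma isHomog_Smat_pow (d : ℕ) : IsHomog m 0 (Smat ℚ m (N := N) ^ d) := by
  simp only [IsHomog, pow_zero, one_smul]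
  rw [← pow_succ, pow_succ']

lemma site_mul_site_self (d e : ℕ) (x y : Matrix (Fin N) (Fin N) ℚ) (j : Fin r) :
    site m d x j * site m e y j = site m (d + e) (x * y) j := by
  simp only [site, kron_mul]
  congr 1
  ext1 i
  split_ifs <;> simp [pow_add]

lemma kron_smul_site (M : Fin r → Matrix (Fin N) (Fin N) ℚ) (c : ℚ) (j : Fin r) :
    kron (fun i => if i = j then c • M i else M i) = c • kron M := by
  ext a b
  simp only [kron, Matrix.smul_apply, smul_eq_mul]
  rw [← Finset.mul_prod_erase _ _ (Finset.mem_univ j), ← Finset.mul_prod_erase _ _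
    (Finset.mem_univ j), ← mul_assoc]
  congr 1
  · simp
  · refine Finset.prod_congr rfl fun i hi => ?_
    simp [Finset.ne_of_mem_erase hi]

lemma site_mul_site_comm {d e : ℕ} {x y : Matrix (Fin N) (Fin N) ℚ} (hx : IsHomog m d x)
    (hy : IsHomog m e y) {j k : Fin r} (hjk : j ≠ k) :
    site m d x j * site m e y k = (-1 : ℚ) ^ (d * e) • (site m e y k * site m d x j) := by
  wlog hlt : j < k generalizing d e x y j k
  · rw [this hy hx hjk.symm (lt_of_le_of_ne (not_lt.mp hlt) hjk.symm), smul_smul, mul_comm e d,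
      ← mul_pow]
    simp
  simp only [site, kron_mul]
  rw [← kron_smul_site _ _ j]
  congr 1
  ext1 i
  rcases lt_trichotomy i j with h | rfl | h
  · simp only [h, h.trans hlt, if_true, h.ne, if_false]
    rw [← pow_add, ← pow_add, add_comm]
  · simp only [lt_irrefl, hlt, if_true, if_false]
    exact hx.mul_Smat_pow m e
  · simp [h.not_gt, h.ne']

lemma Pent_mul_apply (M : Matrix (Fin N × Fin N) (Fin N × Fin N) ℚ) (p p' : Fin N × Fin N) :
    ((Matrix.of (Pent ℚ m) * M : Matrix (Fin N × Fin N) (Fin N × Fin N) ℚ)) p p' =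
      sgn ℚ m p.1 p.2 * M p.swap p' := by
  rw [Matrix.mul_apply, Finset.sum_eq_single p.swap]
  · simp [Pent, Prod.swap]
  · intro u _ hu
    simp only [Matrix.of_apply, Pent]
    have hu' : ¬ u = (p.2, p.1) := hu
    rw [if_neg hu', mul_zero, zero_mul]
  · simp

lemma mul_Pent_apply (M : Matrix (Fin N × Fin N) (Fin N × Fin N) ℚ) (p p' : Fin N × Fin N) :
    ((M * Matrix.of (Pent ℚ m) : Matrix (Fin N × Fin N) (Fin N × Fin N) ℚ)) p p' =
      M p p'.swap * sgn ℚ m p'.2 p'.1 := by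
  rw [Matrix.mul_apply, Finset.sum_eq_single p'.swap]
  · simp [Pent, Prod.swap]
  · intro u _ hu
    simp only [Matrix.of_apply, Pent]
    rw [if_neg (fun h => hu (by rw [h]; rfl)), mul_zero, mul_zero]
  · simp

lemma Pent_one_kronecker {d : ℕ} {x : Matrix (Fin N) (Fin N) ℚ} (hx : IsHomog m d x) :
    (Matrix.of (Pent ℚ m) * (x ⊗ₖ (1 : Matrix (Fin N) (Fin N) ℚ)) :
      Matrix (Fin N × Fin N) (Fin N × Fin N) ℚ) =
      ((Smat ℚ m ^ d) ⊗ₖ x) * Matrix.of (Pent ℚ m) := by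
  ext ⟨a, b⟩ ⟨c, e⟩
  rw [Pent_mul_apply, mul_Pent_apply, Smat_eq, Matrix.diagonal_pow]
  simp only [Matrix.kroneckerMap_apply, Prod.swap, Matrix.one_apply, Matrix.diagonal_apply]
  by_cases hae : a = e
  · subst hae
    have h := hx.apply m b c
    simp only [if_true, Pi.pow_apply, sgn]
    by_cases ha : (a : ℕ) < m
    · simp [deg, ha]
    · have h1 : deg m a = 1 := if_neg ha
      rw [h1, one_mul, one_mul, pow_one, mul_one]
      have hb : ((-1 : ℚ) ^ deg m b) * (-1) ^ deg m b = 1 := by simp [← mul_pow]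
      have hc : ((-1 : ℚ) ^ deg m c) * (-1) ^ deg m c = 1 := by simp [← mul_pow]
      calc (-1 : ℚ) ^ deg m b * x b c
          = (-1) ^ deg m b * (x b c * (-1) ^ deg m c) * (-1) ^ deg m c := by
            rw [mul_assoc, mul_assoc, hc, mul_one]
        _ = ((-1) ^ deg m b * (-1) ^ deg m b) * ((-1) ^ d * x b c * (-1) ^ deg m c) := by
            rw [h]; ring
        _ = _ := by rw [hb]; ring
  · simp [hae]

lemma Tent_one_one {R : Type*} [CommRing R] : Tent (1 : R) 1 m (N := N) = Pent R m := by
  ext ⟨a, b⟩ p'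
  by_cases hab : a = b
  · subst hab
    simp only [Tent, Pent, sgn, deg]
    split_ifs <;> simp_all
  · simp [Tent, Pent, hab]

lemma Pent_mul_self :
    (Matrix.of (Pent ℚ m) * Matrix.of (Pent ℚ m) :
      Matrix (Fin N × Fin N) (Fin N × Fin N) ℚ) = 1 := by
  ext ⟨a, b⟩ ⟨c, e⟩
  rw [Pent_mul_apply, Matrix.of_apply, Pent, Matrix.one_apply]
  by_cases h : (a, b) = (c, e)
  · obtain ⟨rfl, rfl⟩ := Prod.mk.inj h
    simp [sgn, mul_comm (deg m b), ← mul_pow]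
  · have h' : ¬ (c, e) = ((a, b).swap.2, (a, b).swap.1) := Ne.symm h
    rw [if_neg h, if_neg h', mul_zero, mul_zero]

lemma commute_Pent_diagonal (f : Fin N → ℚ) :
    Commute (Matrix.of (Pent ℚ m)) (Matrix.diagonal f ⊗ₖ Matrix.diagonal f) := by
  rw [← Tent_one_one]
  exact commute_Tent_diagonal _ _ _ f

lemma heckeOp_one_one {R : Type*} [CommRing R] {i : ℕ} (h : i + 1 < r) :
    heckeOp (1 : R) 1 m (N := N) r i h = swapOp R m r i h := by
  rw [heckeOp, Tent_one_one, swapOp]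

lemma swapOp_mul_self {i : ℕ} (h : i + 1 < r) :
    swapOp ℚ m (N := N) r i h * swapOp ℚ m r i h = 1 := by
  have hne : (⟨i, Nat.lt_of_succ_lt h⟩ : Fin r) ≠ ⟨i + 1, h⟩ := by simp
  rw [swapOp, twoSiteOp_eq_siteMix, siteMix_mul hne, Pent_mul_self, ← kron_one,
    kron_eq_siteMix hne]
  simp

lemma swapOp_mul_site {d : ℕ} {x : Matrix (Fin N) (Fin N) ℚ} (hx : IsHomog m d x)
    {i : ℕ} (h : i + 1 < r) (j : Fin r) :
    swapOp ℚ m r i h * site m d x j =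
      site m d x (Equiv.swap ⟨i, Nat.lt_of_succ_lt h⟩ ⟨i + 1, h⟩ j) * swapOp ℚ m r i h := by
  have hsq := swapOp_mul_self (N := N) m h
  set s : Fin r := ⟨i, Nat.lt_of_succ_lt h⟩ with hs
  set t : Fin r := ⟨i + 1, h⟩ with ht
  have hst : s ≠ t := by simp [hs, ht]
  have hlt : s < t := by simp [Fin.lt_def, hs, ht]
  have hleft : swapOp ℚ m r i h * site m d x s = site m d x t * swapOp ℚ m r i h := by
    rw [swapOp, twoSiteOp_eq_siteMix, site, site, kron_eq_siteMix hst,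
      kron_eq_siteMix hst (fun k => if k < t then _ else _), siteMix_mul hst, siteMix_mul hst]
    simp only [hlt, hlt.not_gt, hst, hst.symm, lt_irrefl, if_true, if_false]
    rw [Pent_one_kronecker m hx]
    refine siteMix_congr _ fun k hks hkt => ?_
    have h1 : (k : ℕ) ≠ i := fun e => hks (Fin.ext e)
    have h2 : (k : ℕ) ≠ i + 1 := fun e => hkt (Fin.ext e)
    have : k < s ↔ k < t := by simp only [Fin.lt_def, hs, ht]; omega
    simp [hks, hkt, this]
  by_cases hjs : j = s
  · rw [hjs, Equiv.swap_apply_left, hleft]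
  by_cases hjt : j = t
  · rw [hjt, Equiv.swap_apply_right]
    calc swapOp ℚ m r i h * site m d x t
        = swapOp ℚ m r i h * (site m d x t * swapOp ℚ m r i h) * swapOp ℚ m r i h := by
          simp only [mul_assoc, hsq, mul_one]
      _ = site m d x s * swapOp ℚ m r i h := by
          rw [← hleft, ← mul_assoc, hsq, one_mul]
  rw [Equiv.swap_apply_of_ne_of_ne hjs hjt, site, kron_eq_siteMix hst, swapOp]
  refine commute_twoSiteOp_siteMix ?_ _
  have h1 : (j : ℕ) ≠ i := fun e => hjs (Fin.ext e)
  have h2 : (j : ℕ) ≠ i + 1 := fun e => hjt (Fin.ext e)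
  rw [if_neg (Ne.symm hjs), if_neg (Ne.symm hjt)]
  by_cases hsj : s < j
  · have : t < j := by simp only [Fin.lt_def, hs, ht] at hsj ⊢; omega
    simp only [hsj, this, if_true]
    rw [Smat_eq, Matrix.diagonal_pow]
    exact commute_Pent_diagonal m _
  · have : ¬ t < j := by simp only [Fin.lt_def, hs, ht] at hsj ⊢; omega
    simp only [hsj, this, if_false]
    rw [← Matrix.diagonal_one]
    exact commute_Pent_diagonal m _

end JordanWigner

section Words

variable {N r : ℕ} (m : ℕ)

/-- The product of the site operators listed in `w`, with the sites permuted by `σ`. -/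
def wordOp (σ : Equiv.Perm (Fin r)) (w : List (ℕ × Matrix (Fin N) (Fin N) ℚ × Fin r)) :
    Matrix (Fin r → Fin N) (Fin r → Fin N) ℚ :=
  (w.map fun t => site m t.1 t.2.1 (σ t.2.2)).prod

/-- All letters of the word are homogeneous of the stated degree. -/
def IsHomogWord (w : List (ℕ × Matrix (Fin N) (Fin N) ℚ × Fin r)) : Prop :=
  ∀ t ∈ w, IsHomog m t.1 t.2.1

lemma wordOp_cons (σ : Equiv.Perm (Fin r)) (t : ℕ × Matrix (Fin N) (Fin N) ℚ × Fin r)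
    (w : List (ℕ × Matrix (Fin N) (Fin N) ℚ × Fin r)) :
    wordOp m σ (t :: w) = site m t.1 t.2.1 (σ t.2.2) * wordOp m σ w := by
  simp [wordOp]

lemma exists_word_of_mem_sites {d : ℕ} {x : Matrix (Fin N) (Fin N) ℚ} (hx : IsHomog m d x)
    (i : Fin r) (w : List (ℕ × Matrix (Fin N) (Fin N) ℚ × Fin r)) (hw : IsHomogWord m w)
    (hi : i ∈ w.map fun t => t.2.2) :
    ∃ (c : ℚ) (w' : List (ℕ × Matrix (Fin N) (Fin N) ℚ × Fin r)), IsHomogWord m w' ∧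
      w'.length = w.length ∧
      ∀ σ, site m d x (σ i) * wordOp m σ w = c • wordOp m σ w' := by
  induction w with
  | nil => simp at hi
  | cons t w ih =>
    obtain ⟨e, y, k⟩ := t
    have hy : IsHomog m e y := hw (e, y, k) (by simp)
    have hw' : IsHomogWord m w := fun t ht => hw t (List.mem_cons_of_mem _ ht)
    by_cases hik : i = k
    · subst hik
      refine ⟨1, (d + e, x * y, i) :: w, ?_, by simp, fun σ => ?_⟩
      · intro t ht
        rcases List.mem_cons.mp ht with rfl | ht
        · exact hx.mul m hy
        · exact hw' t ht
      · rw [wordOp_cons, wordOp_cons, ← mul_assoc, site_mul_site_self, one_smul]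
    · have hi' : i ∈ w.map fun t => t.2.2 := by simpa [hik] using hi
      obtain ⟨c, w', h1, h2, h3⟩ := ih hw' hi'
      refine ⟨(-1) ^ (d * e) * c, (e, y, k) :: w', ?_, by simp [h2], fun σ => ?_⟩
      · intro t ht
        rcases List.mem_cons.mp ht with rfl | ht
        · exact hy
        · exact h1 t ht
      · rw [wordOp_cons, wordOp_cons, ← mul_assoc,
          site_mul_site_comm m hx hy (fun h => hik (σ.injective h)), smul_mul_assoc, mul_assoc, h3,
          mul_smul_comm, smul_smul]

lemma sum_site_mul_wordOp_eq {d : ℕ} {x : Matrix (Fin N) (Fin N) ℚ} {i j : Fin r}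
    {w : List (ℕ × Matrix (Fin N) (Fin N) ℚ × Fin r)}
    (hi : i ∉ w.map fun t => t.2.2) (hj : j ∉ w.map fun t => t.2.2) :
    ∑ σ : Equiv.Perm (Fin r), site m d x (σ i) * wordOp m σ w =
      ∑ σ : Equiv.Perm (Fin r), site m d x (σ j) * wordOp m σ w := by
  rw [← Equiv.sum_comp (Equiv.mulRight (Equiv.swap i j))]
  refine Finset.sum_congr rfl fun σ _ => ?_
  simp only [Equiv.coe_mulRight, Equiv.Perm.mul_apply, Equiv.swap_apply_left]
  have : wordOp m (σ * Equiv.swap i j) w = wordOp m σ w := by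
    unfold wordOp
    congr 1
    refine List.map_congr_left fun t ht => ?_
    rw [Equiv.Perm.mul_apply, Equiv.swap_apply_of_ne_of_ne]
    · rintro rfl; exact hi (List.mem_map_of_mem ht)
    · rintro rfl; exact hj (List.mem_map_of_mem ht)
  rw [this]

/-- Polarization: symmetrized words lie in every algebra containing all `siteSum`s. -/
lemma sum_wordOp_mem (B : Subalgebra ℚ (Matrix (Fin r → Fin N) (Fin r → Fin N) ℚ))
    (hB : ∀ d x, IsHomog m d x → siteSum m r d x ∈ B)
    (w : List (ℕ × Matrix (Fin N) (Fin N) ℚ × Fin r)) (hw : IsHomogWord m w) :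
    ∑ σ : Equiv.Perm (Fin r), wordOp m σ w ∈ B := by
  induction hp : w.length generalizing w with
  | zero =>
    rw [List.length_eq_zero_iff] at hp
    subst hp
    exact sum_mem fun σ _ => by simp [wordOp]
  | succ p ih =>
    obtain _ | ⟨⟨d, x, j⟩, w⟩ := w
    · simp at hp
    have hx : IsHomog m d x := hw (d, x, j) (by simp)
    have hw' : IsHomogWord m w := fun t ht => hw t (List.mem_cons_of_mem _ ht)
    have hlen : w.length = p := by simpa using hp
    have hmem : ∀ i, i ∈ w.map (fun t => t.2.2) →
        ∑ σ : Equiv.Perm (Fin r), site m d x (σ i) * wordOp m σ w ∈ B := by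
      intro i hi
      obtain ⟨c, w', h1, h2, h3⟩ := exists_word_of_mem_sites m hx i w hw' hi
      simp only [h3, ← Finset.smul_sum]
      exact B.smul_mem (ih w' h1 (h2.trans hlen)) c
    simp only [wordOp_cons]
    by_cases hj : j ∈ w.map fun t => t.2.2
    · exact hmem j hj
    have htot : siteSum m r d x * ∑ σ : Equiv.Perm (Fin r), wordOp m σ w =
        ∑ i, ∑ σ : Equiv.Perm (Fin r), site m d x (σ i) * wordOp m σ w := by
      rw [Finset.sum_comm, Finset.mul_sum]
      refine Finset.sum_congr rfl fun σ _ => ?_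
      rw [siteSum, ← Equiv.sum_comp σ, Finset.sum_mul]
    have htotB := B.mul_mem (hB d x hx) (ih w hw' hlen)
    rw [htot, ← Finset.sum_filter_add_sum_filter_not _ (fun i => i ∈ w.map fun t => t.2.2)] at htotB
    have h1 := B.sub_mem htotB (sum_mem
      (t := Finset.univ.filter fun i => i ∈ w.map fun t => t.2.2)
      fun i hi => hmem i (Finset.mem_filter.mp hi).2)
    rw [add_sub_cancel_left, Finset.sum_congr rfl fun i hi =>
      sum_site_mul_wordOp_eq m (Finset.mem_filter.mp hi).2 hj, Finset.sum_const,
      ← Nat.cast_smul_eq_nsmul ℚ] at h1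
    set c := (Finset.univ.filter fun i => i ∉ w.map fun t => t.2.2).card with hc
    have hc0 : (c : ℚ) ≠ 0 := by
      rw [Nat.cast_ne_zero, hc, Finset.card_ne_zero]
      exact ⟨j, by simpa using hj⟩
    have h2 := B.smul_mem h1 (c : ℚ)⁻¹
    rwa [smul_smul, inv_mul_cancel₀ hc0, one_smul] at h2

/-- The algebra generated by the signed swaps. -/
noncomputable abbrev swapAlg (N m r : ℕ) :
    Subalgebra ℚ (Matrix (Fin r → Fin N) (Fin r → Fin N) ℚ) :=
  Algebra.adjoin ℚ (swapGens ℚ m (N := N) r)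

lemma exists_perm_lift (σ : Equiv.Perm (Fin r)) :
    ∃ g ∈ swapAlg N m r, ∃ g' ∈ swapAlg N m r, g * g' = 1 ∧
      ∀ d x (j : Fin r), IsHomog m d x → g * site m d x j = site m d x (σ j) * g := by
  obtain _ | r := r
  · exact ⟨1, one_mem _, 1, one_mem _, mul_one 1, fun _ _ j => j.elim0⟩
  obtain _ | r := r
  · refine ⟨1, one_mem _, 1, one_mem _, mul_one 1, fun _ _ j _ => ?_⟩
    have h : σ j = j := Fin.ext (by omega)
    rw [h, one_mul, mul_one]
  have hσ : σ ∈ Submonoid.closure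
      (Set.range fun i : Fin (r + 1) ↦ Equiv.swap i.castSucc i.succ) := by
    rw [Equiv.Perm.mclosure_swap_castSucc_succ]; trivial
  induction hσ using Submonoid.closure_induction with
  | mem τ hτ =>
    obtain ⟨i, rfl⟩ := hτ
    have hi : (i : ℕ) + 1 < r + 1 + 1 := by omega
    have hmem : swapOp ℚ m (N := N) (r + 1 + 1) i hi ∈ swapAlg N m (r + 1 + 1) :=
      Algebra.subset_adjoin ⟨i, hi, rfl⟩
    exact ⟨_, hmem, _, hmem, swapOp_mul_self m hi, fun d x j hx => swapOp_mul_site m hx hi j⟩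
  | one => exact ⟨1, one_mem _, 1, one_mem _, mul_one 1, fun _ _ j _ => by simp⟩
  | mul τ υ _ _ h₁ h₂ =>
    obtain ⟨g, hg, g', hg', hgg, hconj⟩ := h₁
    obtain ⟨k, hk, k', hk', hkk, hconj'⟩ := h₂
    refine ⟨g * k, mul_mem hg hk, k' * g', mul_mem hk' hg', ?_, fun d x j hx => ?_⟩
    · rw [mul_assoc, ← mul_assoc k, hkk, one_mul, hgg]
    · rw [mul_assoc, hconj' d x j hx, ← mul_assoc, hconj d x _ hx, mul_assoc,
        Equiv.Perm.mul_apply]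

lemma mul_wordOp {σ : Equiv.Perm (Fin r)} {g : Matrix (Fin r → Fin N) (Fin r → Fin N) ℚ}
    (hg : ∀ d x (j : Fin r), IsHomog m d x → g * site m d x j = site m d x (σ j) * g)
    (w : List (ℕ × Matrix (Fin N) (Fin N) ℚ × Fin r)) (hw : IsHomogWord m w) :
    g * wordOp m 1 w = wordOp m σ w * g := by
  induction w with
  | nil => simp [wordOp]
  | cons t w ih =>
    rw [wordOp_cons, wordOp_cons, ← mul_assoc, Equiv.Perm.one_apply, hg _ _ _ (hw t (by simp)),
      mul_assoc, ih fun t ht => hw t (List.mem_cons_of_mem _ ht), mul_assoc]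

/-- The homogeneous words span the full matrix algebra. -/
lemma mem_span_wordOp (C : Matrix (Fin r → Fin N) (Fin r → Fin N) ℚ) :
    C ∈ Submodule.span ℚ {M | ∃ w, IsHomogWord m w ∧ M = wordOp m (r := r) 1 w} := by
  set A := Algebra.adjoin ℚ {M | ∃ d x, ∃ j : Fin r, IsHomog m d x ∧ M = site m (N := N) d x j}
    with hA
  have hsite : ∀ d x (j : Fin r), IsHomog m d x → site m d x j ∈ A := fun d x j hx =>
    Algebra.subset_adjoin ⟨d, x, j, hx, rfl⟩
  have hset : ∀ (M : Fin r → Matrix (Fin N) (Fin N) ℚ),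
      (∀ j, kron (Function.update 1 j (M j)) ∈ A) →
      ∀ s : Finset (Fin r), kron (fun j => if j ∈ s then M j else 1) ∈ A := by
    intro M hM s
    induction s using Finset.induction_on with
    | empty => simp [kron_one]
    | insert j s hj ih =>
      have := A.mul_mem (hM j) ih
      rw [kron_mul] at this
      convert this using 2
      ext1 k
      by_cases hk : k = j
      · subst hk; simp [hj]
      · simp [hk]
  have hS : ∀ d (s : Finset (Fin r)),
      kron (fun j => if j ∈ s then Smat ℚ m (N := N) ^ d else 1) ∈ A := by
    intro d
    refine hset (fun _ => Smat ℚ m ^ d) fun j => ?_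
    convert hsite 0 (Smat ℚ m ^ d) j (isHomog_Smat_pow m d) using 1
    unfold site
    congr 1
    ext1 i
    by_cases hi : i = j
    · subst hi; simp
    · simp [hi]
  have hsingle : ∀ a b (j : Fin r),
      kron (Function.update 1 j (Matrix.single a b (1 : ℚ) : Matrix (Fin N) (Fin N) ℚ)) ∈ A := by
    intro a b j
    have := A.mul_mem (hsite _ _ j (isHomog_single m a b))
      (hS (deg m a + deg m b) (Finset.univ.filter fun i => i < j))
    rw [site, kron_mul] at this
    convert this using 2
    ext1 i
    by_cases hi : i = j
    · subst hi; simp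
    · by_cases hlt : i < j
      · simp [hi, hlt, ← pow_add, ← two_mul, pow_mul, pow_two, Smat_mul_self]
      · simp [hi, hlt]
  have hC : C ∈ A := by
    rw [Matrix.matrix_eq_sum_single C]
    refine sum_mem fun f _ => sum_mem fun g _ => ?_
    have h := hset (fun j => Matrix.single (f j) (g j) (1 : ℚ)) (fun j => hsingle _ _ j) Finset.univ
    have h' : kron (fun j => Matrix.single (f j) (g j) (1 : ℚ)) = Matrix.single f g 1 := by
      ext a b
      simp only [kron, Matrix.single_apply, Finset.prod_ite_zero, Finset.prod_const_one,
        Finset.mem_univ, true_imp_iff, forall_and, funext_iff]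
    simp only [Finset.mem_univ, if_true, h'] at h
    simpa using A.smul_mem h (C f g)
  rw [hA, ← Subalgebra.mem_toSubmodule, Algebra.adjoin_eq_span] at hC
  refine Submodule.span_mono ?_ hC
  intro M hM
  obtain ⟨l, hl, rfl⟩ := Submonoid.exists_list_of_mem_closure hM
  clear hM
  induction l with
  | nil => exact ⟨[], by simp [IsHomogWord], by simp [wordOp]⟩
  | cons M l ih =>
    obtain ⟨w, hw, h⟩ := ih fun y hy => hl y (List.mem_cons_of_mem _ hy)
    obtain ⟨d, x, j, hx, rfl⟩ := hl M (by simp)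
    refine ⟨(d, x, j) :: w, ?_, ?_⟩
    · intro t ht
      rcases List.mem_cons.mp ht with rfl | ht
      · exact hx
      · exact hw t ht
    · rw [List.prod_cons, h, wordOp_cons, Equiv.Perm.one_apply]

/-- Every operator commuting with the signed permutations lies in each algebra containing all
`siteSum`s. -/
lemma mem_of_commute_swapAlg (B : Subalgebra ℚ (Matrix (Fin r → Fin N) (Fin r → Fin N) ℚ))
    (hB : ∀ d x, IsHomog m d x → siteSum m r d x ∈ B)
    (C : Matrix (Fin r → Fin N) (Fin r → Fin N) ℚ) (hC : ∀ a ∈ swapAlg N m r, Commute C a) :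
    C ∈ B := by
  choose g hg g' hg' hgg hconj using exists_perm_lift (N := N) (r := r) m
  have hsum : ∑ σ, g σ * C * g' σ ∈ B := by
    clear hC
    induction mem_span_wordOp m C using Submodule.span_induction with
    | mem M hM =>
      obtain ⟨w, hw, rfl⟩ := hM
      have : ∀ σ, g σ * wordOp m 1 w * g' σ = wordOp m σ w := fun σ => by
        rw [mul_wordOp m (hconj σ) w hw, mul_assoc, hgg, mul_one]
      simp only [this]
      exact sum_wordOp_mem m B hB w hw
    | zero => simp
    | add M M' _ _ h h' =>
      simp only [mul_add, add_mul, Finset.sum_add_distrib]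
      exact add_mem h h'
    | smul c M _ h =>
      simp only [mul_smul_comm, smul_mul_assoc, ← Finset.smul_sum]
      exact B.smul_mem h c
  have hconst : ∀ σ, g σ * C * g' σ = C := fun σ => by
    rw [← (hC _ (hg σ)).eq, mul_assoc, hgg, mul_one]
  simp only [hconst, Finset.sum_const, Finset.card_univ, ← Nat.cast_smul_eq_nsmul ℚ] at hsum
  have hne : (Fintype.card (Equiv.Perm (Fin r)) : ℚ) ≠ 0 :=
    Nat.cast_ne_zero.mpr Fintype.card_ne_zero
  have := B.smul_mem hsum (Fintype.card (Equiv.Perm (Fin r)) : ℚ)⁻¹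
  rwa [smul_smul, inv_mul_cancel₀ hne, one_smul] at this

end Words

open scoped Matrix

section Classical

variable {N r : ℕ} (m : ℕ)

/-- A matrix on the tensor space which preserves the weight spaces. -/
def IsWeightPreserving {R : Type*} [CommRing R] (X : Matrix (Fin r → Fin N) (Fin r → Fin N) R) :
    Prop :=
  ∀ f g, X f g ≠ 0 → ∀ a, (Finset.univ.filter fun j => f j = a).card =
    (Finset.univ.filter fun j => g j = a).card

lemma siteSum_superCommutator {d e : ℕ} {x y : Matrix (Fin N) (Fin N) ℚ} (hx : IsHomog m d x)
    (hy : IsHomog m e y) :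
    siteSum m r d x * siteSum m r e y - (-1 : ℚ) ^ (d * e) • (siteSum m r e y * siteSum m r d x) =
      siteSum m r (d + e) (x * y) - (-1 : ℚ) ^ (d * e) • siteSum m r (d + e) (y * x) := by
  have h : siteSum m r e y * siteSum m r d x =
      ∑ j, ∑ k, site m e y k * site m d x j := by
    rw [siteSum, siteSum, Finset.sum_mul_sum, Finset.sum_comm]
  rw [h, siteSum, siteSum, Finset.sum_mul_sum, siteSum, siteSum]
  simp only [Finset.smul_sum, ← Finset.sum_sub_distrib]
  refine Finset.sum_congr rfl fun j _ => ?_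
  rw [Finset.sum_eq_single j]
  · rw [site_mul_site_self, site_mul_site_self, add_comm e d]
  · intro k _ hk
    rw [site_mul_site_comm m hx hy (Ne.symm hk), sub_self]
  · simp

lemma siteSum_zero (d : ℕ) : siteSum m r d (0 : Matrix (Fin N) (Fin N) ℚ) = 0 :=
  (siteSumLin m r d).map_zero

lemma siteSum_add_two_mul (d k : ℕ) (x : Matrix (Fin N) (Fin N) ℚ) :
    siteSum m r (d + 2 * k) x = siteSum m r d x := by
  simp only [siteSum, site_add_two_mul]

lemma siteSum_single_mul_single {a b c : Fin N} (hab : a ≠ b) :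
    siteSum m r (deg m a + deg m b) (Matrix.single a b 1) =
      siteSum m r (deg m a + deg m c) (Matrix.single a c 1) *
        siteSum m r (deg m c + deg m b) (Matrix.single c b 1) -
      (-1 : ℚ) ^ ((deg m a + deg m c) * (deg m c + deg m b)) •
        (siteSum m r (deg m c + deg m b) (Matrix.single c b 1) *
          siteSum m r (deg m a + deg m c) (Matrix.single a c 1)) := by
  rw [siteSum_superCommutator m (isHomog_single m a c) (isHomog_single m c b),
    Matrix.single_mul_single_same, Matrix.single_mul_single_of_ne _ _ _ _ hab.symm, siteSum_zero,
    smul_zero, sub_zero, mul_one,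
    show deg m a + deg m c + (deg m c + deg m b) = deg m a + deg m b + 2 * deg m c by ring,
    siteSum_add_two_mul]

lemma siteSum_single_self (a : Fin N) :
    siteSum m r (deg m a + deg m a) (Matrix.single a a 1) =
      Matrix.diagonal fun f => ((Finset.univ.filter fun j => f j = a).card : ℚ) := by
  have h : deg m a + deg m a = 0 + 2 * deg m a := by ring
  rw [h, siteSum_add_two_mul]
  ext f g
  have hs : ∀ j : Fin r, site m 0 (Matrix.single a a 1) j f g =
      if f = g then (if f j = a then 1 else 0) else 0 := by
    intro j
    rw [site_apply]
    by_cases hfg : f = g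
    · subst hfg
      simp [Matrix.single_apply, eq_comm]
    · rw [if_neg hfg]
      obtain ⟨i, hi⟩ := Function.ne_iff.mp hfg
      by_cases hij : i = j
      · subst hij
        rw [Matrix.single_apply, if_neg (fun h => hi (h.1.symm.trans h.2)), zero_mul]
      · rw [Finset.prod_eq_zero (Finset.mem_erase.mpr ⟨hij, Finset.mem_univ i⟩), mul_zero]
        simp [hi]
  simp only [siteSum, Matrix.sum_apply, hs, Matrix.diagonal_apply]
  split_ifs <;> simp

lemma commute_siteSum_single_self {X : Matrix (Fin r → Fin N) (Fin r → Fin N) ℚ}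
    (hX : IsWeightPreserving X) (a : Fin N) :
    Commute X (siteSum m r (deg m a + deg m a) (Matrix.single a a 1)) := by
  rw [siteSum_single_self]
  ext f g
  rw [Matrix.mul_diagonal, Matrix.diagonal_mul]
  by_cases h : X f g = 0
  · simp [h]
  · rw [hX f g h a, mul_comm]

lemma Dmat_one_one (k : ℕ) : Dmat (1 : ℚ) 1 m (N := N) k = 1 := by
  ext a b
  simp [Dmat, Matrix.one_apply]

lemma SPmat_eq_pow {k : ℕ} {a b : Fin N} (ha : (a : ℕ) = k) (hb : (b : ℕ) = k + 1) :
    SPmat ℚ m (N := N) k = Smat ℚ m ^ (deg m a + deg m b) := by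
  have h0 : Smat ℚ m (N := N) ^ 2 = 1 := by rw [pow_two, Smat_mul_self]
  simp only [SPmat, deg, ha, hb]
  split_ifs <;> first | omega | simp [h0]

lemma rhoE_one_one {k : ℕ} {a b : Fin N} (ha : (a : ℕ) = k) (hb : (b : ℕ) = k + 1) :
    rhoE (1 : ℚ) 1 m r k = siteSum m r (deg m b + deg m a) (Matrix.single b a 1) := by
  have hE : (Emat ℚ k : Matrix (Fin N) (Fin N) ℚ) = Matrix.single b a 1 := by
    ext i j
    simp only [Emat, Matrix.single_apply, Fin.ext_iff, ha, hb]
    congr 1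
    simp only [eq_comm]
  simp only [rhoE, siteSum, site, Dinvmat, Dmat_one_one, SPmat_eq_pow m ha hb, hE,
    add_comm (deg m b)]

lemma rhoF_one_one {k : ℕ} {a b : Fin N} (ha : (a : ℕ) = k) (hb : (b : ℕ) = k + 1) :
    rhoF (1 : ℚ) 1 m r k = siteSum m r (deg m a + deg m b) (Matrix.single a b 1) := by
  have hF : (Fmat ℚ k : Matrix (Fin N) (Fin N) ℚ) = Matrix.single a b 1 := by
    ext i j
    simp only [Fmat, Matrix.single_apply, Fin.ext_iff, ha, hb]
    congr 1
    simp only [eq_comm]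
  simp only [rhoF, siteSum, site, Dmat_one_one, SPmat_eq_pow m ha hb, hF, mul_one]

lemma siteSum_mem_of_single_mem (B : Subalgebra ℚ (Matrix (Fin r → Fin N) (Fin r → Fin N) ℚ))
    (hB : ∀ a b, siteSum m r (deg m a + deg m b) (Matrix.single a b 1) ∈ B) {d : ℕ}
    {x : Matrix (Fin N) (Fin N) ℚ} (hx : IsHomog m d x) : siteSum m r d x ∈ B := by
  have hS : Smat ℚ m (N := N) ^ 2 = 1 := by rw [pow_two, Smat_mul_self]
  change siteSumLin m r d x ∈ B
  rw [Matrix.matrix_eq_sum_single x, map_sum]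
  refine sum_mem fun a _ => ?_
  rw [map_sum]
  refine sum_mem fun b _ => ?_
  by_cases h0 : x a b = 0
  · rw [h0, Matrix.single_zero, map_zero]
    exact B.zero_mem
  have hpar : (-1 : ℚ) ^ deg m b = (-1) ^ (d + deg m a) := by
    have := hx.apply m a b
    rw [pow_add]
    exact mul_left_cancel₀ h0 (by rw [this]; ring)
  have hsite : siteSumLin m r d (Matrix.single a b (1 : ℚ)) =
      siteSum m r (deg m a + deg m b) (Matrix.single a b 1) := by
    have hparity : d % 2 = (deg m a + deg m b) % 2 := by
      rw [neg_one_pow_eq_pow_mod_two, neg_one_pow_eq_pow_mod_two (d + deg m a)] at hpar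
      rcases Nat.mod_two_eq_zero_or_one (deg m b) with h1 | h1 <;>
      rcases Nat.mod_two_eq_zero_or_one (d + deg m a) with h2 | h2 <;>
      first | omega | norm_num [h1, h2] at hpar
    have h1 := siteSum_add_two_mul (r := r) m (d % 2) (d / 2) (Matrix.single a b (1 : ℚ))
    have h2 := siteSum_add_two_mul (r := r) m ((deg m a + deg m b) % 2) ((deg m a + deg m b) / 2)
      (Matrix.single a b (1 : ℚ))
    rw [Nat.mod_add_div] at h1 h2
    rw [h2, ← hparity, ← h1]
    rfl
  have := B.smul_mem (hsite ▸ hB a b) (x a b)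
  rwa [← map_smul, Matrix.smul_single, smul_eq_mul, mul_one] at this

lemma swapOp_transpose {i : ℕ} (h : i + 1 < r) :
    (swapOp ℚ m (N := N) r i h)ᵀ = swapOp ℚ m r i h := by
  ext f g
  simp only [Matrix.transpose_apply, swapOp, twoSiteOp]
  congr 1
  · simp only [Pent, Prod.mk.injEq]
    split_ifs with h1 h2 h2
    · rw [h1.1, h1.2, sgn, sgn, mul_comm (deg m _)]
    · exact absurd ⟨h1.2.symm, h1.1.symm⟩ h2
    · exact absurd ⟨h2.2.symm, h2.1.symm⟩ h1
    · simp
  · simp only [eq_comm]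

lemma transpose_mem_swapAlg {a : Matrix (Fin r → Fin N) (Fin r → Fin N) ℚ}
    (ha : a ∈ swapAlg N m r) : aᵀ ∈ swapAlg N m r := by
  induction ha using Algebra.adjoin_induction with
  | mem x hx =>
    obtain ⟨i, h, rfl⟩ := hx
    rw [swapOp_transpose]
    exact Algebra.subset_adjoin ⟨i, h, rfl⟩
  | algebraMap c =>
    rw [Matrix.algebraMap_eq_diagonal, Matrix.diagonal_transpose, ← Matrix.algebraMap_eq_diagonal]
    exact Subalgebra.algebraMap_mem _ c
  | add x y _ _ hx hy => rw [Matrix.transpose_add]; exact add_mem hx hy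
  | mul x y _ _ hx hy => rw [Matrix.transpose_mul]; exact mul_mem hy hx

/-- The classical double centralizer theorem for the signed permutation action. -/
lemma mem_swapAlg_of_commute {X : Matrix (Fin r → Fin N) (Fin r → Fin N) ℚ}
    (hw : IsWeightPreserving X) (hE : ∀ k, k + 1 < N → Commute X (rhoE 1 1 m r k))
    (hF : ∀ k, k + 1 < N → Commute X (rhoF 1 1 m r k)) : X ∈ swapAlg N m r := by
  set B := Subalgebra.centralizer ℚ {X} with hBdef
  have memB : ∀ {Y}, Y ∈ B ↔ Commute X Y := by
    intro Y
    rw [hBdef, Subalgebra.mem_centralizer_iff]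
    simp [commute_iff_eq]
  have hgap : ∀ n, ∀ a b : Fin N, (b : ℕ) = a + (n + 1) →
      siteSum m r (deg m a + deg m b) (Matrix.single a b 1) ∈ B ∧
        siteSum m r (deg m b + deg m a) (Matrix.single b a 1) ∈ B := by
    intro n
    induction n with
    | zero =>
      intro a b hab
      have hk : (a : ℕ) + 1 < N := by omega
      rw [← rhoE_one_one m rfl hab, ← rhoF_one_one m rfl hab, memB, memB]
      exact ⟨hF _ hk, hE _ hk⟩
    | succ n ih =>
      intro a b hab
      have hc : (a : ℕ) + (n + 1) < N := by omega
      set c : Fin N := ⟨a + (n + 1), hc⟩ with hcdef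
      obtain ⟨h1, h2⟩ := ih a c rfl
      have hcb : (b : ℕ) = c + 1 := by rw [hab, hcdef, ← add_assoc, add_assoc]
      have hk : (c : ℕ) + 1 < N := by omega
      have h3 := memB.mpr (hF _ hk)
      have h4 := memB.mpr (hE _ hk)
      rw [rhoF_one_one m rfl hcb] at h3
      rw [rhoE_one_one m rfl hcb] at h4
      have hne : a ≠ b := fun h => by rw [h] at hab; omega
      rw [siteSum_single_mul_single m (c := c) hne, siteSum_single_mul_single m (c := c) hne.symm]
      exact ⟨B.sub_mem (B.mul_mem h1 h3) (B.smul_mem (B.mul_mem h3 h1) _),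
        B.sub_mem (B.mul_mem h4 h2) (B.smul_mem (B.mul_mem h2 h4) _)⟩
  have hsingle : ∀ a b, siteSum m r (deg m a + deg m b) (Matrix.single a b 1) ∈ B := by
    intro a b
    rcases lt_trichotomy (a : ℕ) b with h | h | h
    · exact (hgap (b - a - 1) a b (by omega)).1
    · obtain rfl := Fin.ext h
      exact memB.mpr (commute_siteSum_single_self m hw a)
    · exact (hgap (a - b - 1) b a (by omega)).2
  refine mem_of_commute_centralizer _ (fun a ha => transpose_mem_swapAlg m ha) X fun C hC => ?_
  exact memB.mp (mem_of_commute_swapAlg m B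
    (fun d x hx => siteSum_mem_of_single_mem m B hsingle hx) C hC)

end Classical

section Functoriality

variable {R S : Type*} [CommRing R] [CommRing S] (φ : R →+* S) (x xinv : R) (m : ℕ) {N r : ℕ}

lemma kron_map (M : Fin r → Matrix (Fin N) (Fin N) R) :
    (kron M).map φ = kron fun j => (M j).map φ := by
  ext f g
  simp [kron, map_prod]

lemma Smat_map : (Smat R m (N := N)).map φ = Smat S m := by
  ext a b
  simp only [Smat, Matrix.map_apply]
  split_ifs <;> simp

lemma SPmat_map (k : ℕ) : (SPmat R m (N := N) k).map φ = SPmat S m k := by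
  unfold SPmat
  split_ifs
  · exact Smat_map φ m
  · exact Matrix.map_one _ (map_zero φ) (map_one φ)

lemma Emat_map (k : ℕ) : (Emat R (N := N) k).map φ = Emat S k := by
  ext a b
  simp only [Emat, Matrix.map_apply]
  split_ifs <;> simp

lemma Fmat_map (k : ℕ) : (Fmat R (N := N) k).map φ = Fmat S k := by
  ext a b
  simp only [Fmat, Matrix.map_apply]
  split_ifs <;> simp

lemma Dmat_map (k : ℕ) : (Dmat x xinv m (N := N) k).map φ = Dmat (φ x) (φ xinv) m k := by
  ext a b
  simp only [Dmat, Matrix.map_apply]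
  split_ifs <;> simp

lemma rhoE_map (k : ℕ) :
    (rhoE x xinv m (N := N) r k).map φ = rhoE (φ x) (φ xinv) m r k := by
  rw [← RingHom.mapMatrix_apply, rhoE, map_sum]
  refine Finset.sum_congr rfl fun p _ => ?_
  rw [RingHom.mapMatrix_apply, kron_map]
  congr 1
  ext1 j
  split_ifs
  · exact SPmat_map φ m k
  · exact Emat_map φ k
  · exact Dmat_map φ xinv x m k

lemma rhoF_map (k : ℕ) :
    (rhoF x xinv m (N := N) r k).map φ = rhoF (φ x) (φ xinv) m r k := by
  rw [← RingHom.mapMatrix_apply, rhoF, map_sum]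
  refine Finset.sum_congr rfl fun p _ => ?_
  rw [RingHom.mapMatrix_apply, kron_map]
  congr 1
  ext1 j
  split_ifs
  · rw [Matrix.map_mul, SPmat_map, Dmat_map]
  · exact Fmat_map φ k
  · exact Matrix.map_one _ (map_zero φ) (map_one φ)

lemma heckeOp_map {i : ℕ} (h : i + 1 < r) :
    (heckeOp x xinv m (N := N) r i h).map φ = heckeOp (φ x) (φ xinv) m r i h := by
  ext f g
  simp only [heckeOp, twoSiteOp, Matrix.map_apply, map_mul, map_prod]
  congr 1
  · simp only [Tent, sgn]
    split_ifs <;> simp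
  · refine Finset.prod_congr rfl fun j _ => ?_
    split_ifs <;> simp

lemma Qmat_map (b : Fin N) : (Qmat x b).map φ = Qmat (φ x) b := by
  ext i j
  simp only [Qmat, Matrix.map_apply]
  split_ifs <;> simp

lemma map_mem_quantumGens {G : Matrix (Fin r → Fin N) (Fin r → Fin N) R}
    (hG : G ∈ quantumGens x xinv m r) : G.map φ ∈ quantumGens (φ x) (φ xinv) m r := by
  rcases hG with (((hG | ⟨b, rfl⟩) | ⟨b, rfl⟩) | ⟨k, rfl⟩) | ⟨k, rfl⟩
  · obtain rfl := hG
    refine Or.inl (Or.inl (Or.inl (Or.inl ?_)))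
    simp only [rhoSigma, kron_map, Smat_map, Set.mem_singleton_iff]
  · refine Or.inl (Or.inl (Or.inl (Or.inr ⟨b, ?_⟩)))
    simp only [rhoQ, kron_map, Qmat_map]
  · refine Or.inl (Or.inl (Or.inr ⟨b, ?_⟩))
    simp only [rhoQ, kron_map, Qmat_map]
  · exact Or.inl (Or.inr ⟨k, (rhoE_map φ x xinv m k).symm⟩)
  · exact Or.inr ⟨k, (rhoF_map φ x xinv m k).symm⟩

end Functoriality

section WeightSpaces

variable {R : Type*} [CommRing R] {N r : ℕ}

lemma rhoQ_eq_diagonal (x : R) (b : Fin N) :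
    rhoQ x r b = Matrix.diagonal fun f => x ^ (Finset.univ.filter fun j => f j = b).card := by
  ext f g
  by_cases hfg : f = g
  · subst hfg
    simp [rhoQ, kron, Qmat, Finset.prod_ite]
  · obtain ⟨i, hi⟩ := Function.ne_iff.mp hfg
    rw [Matrix.diagonal_apply_ne _ hfg]
    exact Finset.prod_eq_zero (Finset.mem_univ i) (if_neg hi)

lemma isWeightPreserving_of_commute [IsDomain R] {x : R} (hx : Function.Injective (x ^ · : ℕ → R))
    {X : Matrix (Fin r → Fin N) (Fin r → Fin N) R} (hX : ∀ b, Commute X (rhoQ x r b)) :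
    IsWeightPreserving X := by
  intro f g hfg b
  have h := congrFun (congrFun (hX b).eq f) g
  rw [rhoQ_eq_diagonal, Matrix.mul_diagonal, Matrix.diagonal_mul, mul_comm] at h
  exact (hx (mul_right_cancel₀ hfg h)).symm

end WeightSpaces

section Specialization

variable {O : Type*} [CommRing O] (x xinv : O) {m N r : ℕ}

/-- The centralizer of the quantum generators, as a submodule. -/
def quantumCentralizer (m N r : ℕ) : Submodule O (Matrix (Fin r → Fin N) (Fin r → Fin N) O) where
  carrier := {Y | ∀ G ∈ quantumGens x xinv m r, Commute Y G}
  zero_mem' G _ := Commute.zero_left G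
  add_mem' hY hZ G hG := (hY G hG).add_left (hZ G hG)
  smul_mem' c _ hY G hG := (hY G hG).smul_left c

variable {x xinv}

lemma adjoin_heckeGens_le_quantumCentralizer (hx : x * xinv = 1) :
    Subalgebra.toSubmodule (Algebra.adjoin O (heckeGens x xinv m (N := N) r)) ≤
      quantumCentralizer x xinv m N r := by
  intro Y hY G hG
  induction (hY : Y ∈ Algebra.adjoin O _) using Algebra.adjoin_induction with
  | mem Z hZ =>
    obtain ⟨i, h, rfl⟩ := hZ
    exact commute_heckeOp_of_mem_quantumGens hx i h hG
  | algebraMap c => exact Algebra.commutes c G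
  | add Z W _ _ hZ hW => exact hZ.add_left hW
  | mul Z W _ _ hZ hW => exact hZ.mul_left hW

lemma exists_map_eq_of_mem_swapAlg (ev : O →+* ℚ) (hsurj : Function.Surjective ev) (hx : ev x = 1)
    (hxinv : ev xinv = 1) {A : Matrix (Fin r → Fin N) (Fin r → Fin N) ℚ}
    (hA : A ∈ swapAlg N m r) :
    ∃ Z ∈ Algebra.adjoin O (heckeGens x xinv m (N := N) r), Z.map ev = A := by
  induction hA using Algebra.adjoin_induction with
  | mem B hB =>
    obtain ⟨i, h, rfl⟩ := hB
    refine ⟨_, Algebra.subset_adjoin ⟨i, h, rfl⟩, ?_⟩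
    rw [heckeOp_map, hx, hxinv, heckeOp_one_one]
  | algebraMap c =>
    obtain ⟨d, rfl⟩ := hsurj c
    refine ⟨_, Subalgebra.algebraMap_mem _ d, ?_⟩
    rw [Matrix.algebraMap_eq_diagonal, Matrix.algebraMap_eq_diagonal, Matrix.diagonal_map]
    · rfl
    · exact map_zero ev
  | add B C _ _ hB hC =>
    obtain ⟨Z, hZ, rfl⟩ := hB
    obtain ⟨W, hW, rfl⟩ := hC
    exact ⟨_, add_mem hZ hW, Matrix.map_add _ (map_add ev) _ _⟩
  | mul B C _ _ hB hC =>
    obtain ⟨Z, hZ, rfl⟩ := hB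
    obtain ⟨W, hW, rfl⟩ := hC
    exact ⟨_, mul_mem hZ hW, Matrix.map_mul⟩

lemma map_mem_swapAlg_of_mem_quantumCentralizer [IsDomain O] (ev : O →+* ℚ) (hx : ev x = 1)
    (hxinv : ev xinv = 1) (hinj : Function.Injective (x ^ · : ℕ → O))
    {Y : Matrix (Fin r → Fin N) (Fin r → Fin N) O} (hY : Y ∈ quantumCentralizer x xinv m N r) :
    Y.map ev ∈ swapAlg N m r := by
  have hcomm : ∀ {G}, G ∈ quantumGens x xinv m r → Commute (Y.map ev) (G.map ev) :=
    fun hG => (hY _ hG).map ev.mapMatrix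
  refine mem_swapAlg_of_commute m ?_ (fun k hk => ?_) (fun k hk => ?_)
  · intro f g hfg
    exact isWeightPreserving_of_commute hinj
      (fun b => hY _ (Or.inl (Or.inl (Or.inl (Or.inr ⟨b, rfl⟩))))) f g
      fun h => hfg (by rw [Matrix.map_apply, h, map_zero])
  · have h := hcomm (Or.inl (Or.inr ⟨⟨k, by omega⟩, rfl⟩))
    rwa [rhoE_map, hx, hxinv] at h
  · have h := hcomm (Or.inr ⟨⟨k, by omega⟩, rfl⟩)
    rwa [rhoF_map, hx, hxinv] at h

/-- Lifting the classical double centralizer theorem from `q = 1` by Nakayama's lemma. -/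
lemma exists_smul_mem_adjoin_heckeGens [IsDomain O] [IsNoetherianRing O] (ev : O →+* ℚ)
    (hsurj : Function.Surjective ev) {ϖ : O} (hϖ : ϖ ≠ 0) (hker : RingHom.ker ev = Ideal.span {ϖ})
    (hxx : x * xinv = 1) (hx : ev x = 1) (hinj : Function.Injective (x ^ · : ℕ → O)) :
    ∃ s : O, s ≠ 0 ∧ ∀ Y ∈ quantumCentralizer x xinv m N r,
      s • Y ∈ Algebra.adjoin O (heckeGens x xinv m (N := N) r) := by
  have hxinv : ev xinv = 1 := by
    have := congrArg ev hxx
    rwa [map_mul, hx, one_mul, map_one] at this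
  have hle := adjoin_heckeGens_le_quantumCentralizer (m := m) (N := N) (r := r) hxx
  obtain ⟨s, hs, hsL⟩ := Submodule.exists_sub_one_mem_and_smul_le_of_fg_of_le_sup
    (I := RingHom.ker ev) (N := Subalgebra.toSubmodule (Algebra.adjoin O (heckeGens x xinv m r)))
    (N' := quantumCentralizer x xinv m N r) (P := quantumCentralizer x xinv m N r)
    (IsNoetherian.noetherian _) le_rfl fun Y hY => by
      obtain ⟨Z, hZ, hZY⟩ := exists_map_eq_of_mem_swapAlg ev hsurj hx hxinv
        (map_mem_swapAlg_of_mem_quantumCentralizer ev hx hxinv hinj hY)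
      have hdiv : ∀ f g, ∃ w, Y f g - Z f g = ϖ * w := fun f g => by
        have h : Y f g - Z f g ∈ RingHom.ker ev := by
          have := congrFun (congrFun hZY f) g
          rw [RingHom.mem_ker, map_sub, sub_eq_zero]
          exact this.symm
        rw [hker] at h
        exact Ideal.mem_span_singleton.mp h
      choose W hW using hdiv
      have hYZ : Y = Z + ϖ • Matrix.of W := by
        ext f g
        simp [← hW]
      have hWL : Matrix.of W ∈ quantumCentralizer x xinv m N r := by
        intro G hG
        have h : Commute (ϖ • Matrix.of W) G := by
          have : ϖ • Matrix.of W = Y - Z := by rw [hYZ, add_sub_cancel_left]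
          rw [this]
          exact (hY G hG).sub_left (hle hZ G hG)
        have h' := h.eq
        rw [smul_mul_assoc, mul_smul_comm] at h'
        exact smul_right_injective _ hϖ h'
      rw [hYZ]
      refine Submodule.add_mem_sup hZ (Submodule.smul_mem_smul ?_ hWL)
      rw [hker]
      exact Ideal.mem_span_singleton_self ϖ
  refine ⟨s, ?_, fun Y hY => hsL (Submodule.smul_mem_pointwise_smul Y s _ hY)⟩
  rintro rfl
  rw [RingHom.mem_ker, map_sub, map_zero, map_one] at hs
  norm_num at hs

lemma map_mem_adjoin_heckeGens {K : Type*} [CommRing K] [Algebra O K]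
    {Y : Matrix (Fin r → Fin N) (Fin r → Fin N) O}
    (hY : Y ∈ Algebra.adjoin O (heckeGens x xinv m r)) :
    Y.map (algebraMap O K) ∈
      Algebra.adjoin K (heckeGens (algebraMap O K x) (algebraMap O K xinv) m r) := by
  induction hY using Algebra.adjoin_induction with
  | mem B hB =>
    obtain ⟨i, h, rfl⟩ := hB
    exact Algebra.subset_adjoin ⟨i, h, heckeOp_map _ _ _ _ h⟩
  | algebraMap c =>
    rw [Matrix.algebraMap_eq_diagonal, Matrix.diagonal_map (map_zero _)]
    exact Subalgebra.algebraMap_mem (Algebra.adjoin K _) (algebraMap O K c)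
  | add B C _ _ hB hC =>
    rw [Matrix.map_add _ (map_add _)]
    exact add_mem hB hC
  | mul B C _ _ hB hC =>
    rw [Matrix.map_mul]
    exact mul_mem hB hC

/-- The passage to the fraction field. -/
lemma mem_adjoin_heckeGens_of_commute [IsDomain O] [IsNoetherianRing O] (ev : O →+* ℚ)
    (hsurj : Function.Surjective ev) {ϖ : O} (hϖ : ϖ ≠ 0) (hker : RingHom.ker ev = Ideal.span {ϖ})
    (hxx : x * xinv = 1) (hx : ev x = 1) (hinj : Function.Injective (x ^ · : ℕ → O))
    {K : Type*} [Field K] [Algebra O K] [IsFractionRing O K]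
    {X : Matrix (Fin r → Fin N) (Fin r → Fin N) K}
    (hX : ∀ G ∈ quantumGens (algebraMap O K x) (algebraMap O K xinv) m r, Commute X G) :
    X ∈ Algebra.adjoin K (heckeGens (algebraMap O K x) (algebraMap O K xinv) m r) := by
  have hφ : Function.Injective (algebraMap O K) := IsFractionRing.injective O K
  obtain ⟨s, hs, hsL⟩ := exists_smul_mem_adjoin_heckeGens (m := m) (N := N) (r := r)
    ev hsurj hϖ hker hxx hx hinj
  obtain ⟨b, hb⟩ := IsLocalization.exist_integer_multiples_of_finite (nonZeroDivisors O)
    fun p : (Fin r → Fin N) × (Fin r → Fin N) => X p.1 p.2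
  choose Y hY using hb
  have hYX : (Matrix.of fun f g => Y (f, g)).map (algebraMap O K) = algebraMap O K b • X := by
    ext f g
    simp [hY, Algebra.smul_def]
  have hYL : (Matrix.of fun f g => Y (f, g)) ∈ quantumCentralizer x xinv m N r := by
    intro G hG
    have h := (hX _ (map_mem_quantumGens (algebraMap O K) x xinv m hG)).smul_left
      (algebraMap O K b)
    rw [← hYX] at h
    apply Matrix.map_injective hφ
    simpa only [Matrix.map_mul] using h.eq
  have h := map_mem_adjoin_heckeGens (K := K) (hsL _ hYL)
  have hsb : algebraMap O K s * algebraMap O K b ≠ 0 :=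
    mul_ne_zero ((map_ne_zero_iff _ hφ).mpr hs)
      ((map_ne_zero_iff _ hφ).mpr (nonZeroDivisors.coe_ne_zero b))
  have hmap : (s • Matrix.of fun f g => Y (f, g)).map (algebraMap O K) =
      (algebraMap O K s * algebraMap O K b) • X := by
    rw [mul_smul, ← hYX]
    ext f g
    simp
  rw [hmap] at h
  have h' := Subalgebra.smul_mem _ h (algebraMap O K s * algebraMap O K b)⁻¹
  rwa [smul_smul, inv_mul_cancel₀ hsb, one_smul] at h'

end Specialization

section LaurentSubalgebra

open Polynomial

lemma powers_X_le_nonZeroDivisors : Submonoid.powers (X : ℚ[X]) ≤ nonZeroDivisors ℚ[X] :=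
  powers_le_nonZeroDivisors_of_noZeroDivisors X_ne_zero

/-- The ring `ℚ[q, q⁻¹]` inside `ℚ(q)`. -/
noncomputable abbrev laurentSubalgebra : Subalgebra ℚ[X] 𝕂 :=
  Localization.subalgebra.ofField 𝕂 (Submonoid.powers (X : ℚ[X])) powers_X_le_nonZeroDivisors

/-- The specialization `q = 1`. -/
noncomputable def laurentEvalOne : laurentSubalgebra →+* ℚ :=
  IsLocalization.lift (M := Submonoid.powers (X : ℚ[X])) (g := evalRingHom (1 : ℚ)) <| by
    rintro ⟨_, n, rfl⟩
    simp

lemma laurentEvalOne_algebraMap (p : ℚ[X]) :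
    laurentEvalOne (algebraMap ℚ[X] laurentSubalgebra p) = p.eval 1 :=
  IsLocalization.lift_eq _ _

lemma ker_laurentEvalOne : RingHom.ker laurentEvalOne =
    Ideal.span {algebraMap ℚ[X] laurentSubalgebra (X - C 1)} := by
  ext a
  rw [RingHom.mem_ker, Ideal.mem_span_singleton]
  constructor
  · intro ha
    obtain ⟨⟨p, s⟩, hps⟩ := IsLocalization.surj (Submonoid.powers (X : ℚ[X])) a
    have hp : p.eval 1 = 0 := by
      rw [← laurentEvalOne_algebraMap, ← hps, map_mul, ha, zero_mul]
    obtain ⟨p', rfl⟩ := dvd_iff_isRoot.mpr hp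
    exact (IsLocalization.map_units laurentSubalgebra s).dvd_mul_right.mp
      ⟨_, hps.trans (map_mul _ _ _)⟩
  · rintro ⟨b, rfl⟩
    rw [map_mul, laurentEvalOne_algebraMap]
    simp

lemma mem_adjoin_heckeGens_q {m N r : ℕ} {X : Matrix (Fin r → Fin N) (Fin r → Fin N) 𝕂}
    (hX : ∀ G ∈ quantumGens q q⁻¹ m r, Commute X G) :
    X ∈ Algebra.adjoin 𝕂 (heckeGens q q⁻¹ m r) := by
  set x := algebraMap ℚ[X] laurentSubalgebra Polynomial.X with hx
  have hinj : Function.Injective (algebraMap ℚ[X] laurentSubalgebra) :=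
    IsLocalization.injective _ powers_X_le_nonZeroDivisors
  obtain ⟨xinv, hxx⟩ := isUnit_iff_exists_inv.mp
    (IsLocalization.map_units laurentSubalgebra
      (⟨Polynomial.X, Submonoid.mem_powers _⟩ : Submonoid.powers (Polynomial.X : ℚ[X])))
  have hq : algebraMap laurentSubalgebra 𝕂 x = q := by
    rw [hx, ← IsScalarTower.algebraMap_apply, RatFunc.algebraMap_X, q]
  have hqinv : algebraMap laurentSubalgebra 𝕂 xinv = q⁻¹ := by
    rw [← hq]
    exact eq_inv_of_mul_eq_one_right (by rw [← map_mul, hxx, map_one])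
  have : IsNoetherianRing laurentSubalgebra :=
    IsLocalization.isNoetherianRing (Submonoid.powers (Polynomial.X : ℚ[X])) _ inferInstance
  rw [← hqinv, ← hq] at hX ⊢
  refine mem_adjoin_heckeGens_of_commute laurentEvalOne (fun c => ⟨algebraMap _ _ (C c), ?_⟩) ?_
    ker_laurentEvalOne hxx ?_ ?_ hX
  · rw [laurentEvalOne_algebraMap, eval_C]
  · exact (map_ne_zero_iff _ hinj).mpr (X_sub_C_ne_zero 1)
  · rw [laurentEvalOne_algebraMap, eval_X]
  · intro i j hij
    have h : (Polynomial.X : ℚ[X]) ^ i = Polynomial.X ^ j := hinj (by simpa using hij)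
    simpa using congrArg natDegree h

end LaurentSubalgebra

section VecMul

variable {I K : Type*} [Fintype I] [Field K]

lemma vecMulLinear_mul_vecMulLinear (M N : Matrix I I K) :
    (M.vecMulLinear * N.vecMulLinear : Module.End K (I → K)) = (N * M).vecMulLinear := by
  refine LinearMap.ext fun v => ?_
  simp

variable [DecidableEq I]

lemma exists_vecMulLinear_eq (f : Module.End K (I → K)) : ∃ M : Matrix I I K,
    M.vecMulLinear = f :=
  ⟨LinearMap.toMatrixRight' f, (LinearMap.toMatrixRight' (R := K)).symm_apply_apply f⟩

lemma vecMulLinear_mem_adjoin {s : Set (Matrix I I K)} {M : Matrix I I K}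
    (hM : M ∈ Algebra.adjoin K s) :
    M.vecMulLinear ∈ Algebra.adjoin K (Matrix.vecMulLinear '' s) := by
  induction hM using Algebra.adjoin_induction with
  | mem M hM => exact Algebra.subset_adjoin ⟨M, hM, rfl⟩
  | algebraMap c =>
    have : (algebraMap K (Matrix I I K) c).vecMulLinear = algebraMap K (Module.End K (I → K)) c := by
      refine LinearMap.ext fun v => ?_
      simp [Algebra.algebraMap_eq_smul_one]
    rw [this]
    exact Subalgebra.algebraMap_mem _ c
  | add M N _ _ hM hN =>
    have : (M + N).vecMulLinear = M.vecMulLinear + N.vecMulLinear := by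
      refine LinearMap.ext fun v => ?_
      simp
    rw [this]
    exact add_mem hM hN
  | mul M N _ _ hM hN =>
    rw [← vecMulLinear_mul_vecMulLinear]
    exact mul_mem hN hM

end VecMul

lemma commute_of_mem_Aq_of_mem_Bq {m n r : ℕ} {X Y : Module.End 𝕂 ((Fin r → Fin (m + n)) → 𝕂)}
    (hX : X ∈ Aq m n r) (hY : Y ∈ Bq m n r) : Commute X Y := by
  refine Algebra.commute_of_mem_adjoin_of_forall_mem_commute hY fun b hb => ?_
  refine (Algebra.commute_of_mem_adjoin_of_forall_mem_commute hX fun a ha => ?_).symm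
  obtain ⟨M, ⟨i, h, rfl⟩, rfl⟩ := ha
  obtain ⟨G, hG, rfl⟩ := hb
  rw [commute_iff_eq, vecMulLinear_mul_vecMulLinear, vecMulLinear_mul_vecMulLinear,
    (commute_heckeOp_of_mem_quantumGens (mul_inv_cancel₀ RatFunc.X_ne_zero) i h hG).eq]

/-- Schur–Weyl reciprocity, first half. The centralizer in
`End_K(V^{⊗ r})` of `ℬ_q` equals `𝒜_q`. -/
theorem centralizer_Bq_eq_Aq (m n r : ℕ) (hm : 1 ≤ m) (hn : 1 ≤ n) (hr : 2 ≤ r) :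
    {X : Module.End 𝕂 ((Fin r → Fin (m + n)) → 𝕂) |
        ∀ Y ∈ (Bq m n r : Set (Module.End 𝕂 ((Fin r → Fin (m + n)) → 𝕂))), X * Y = Y * X}
      = (Aq m n r : Set (Module.End 𝕂 ((Fin r → Fin (m + n)) → 𝕂))) := by
  ext X
  refine ⟨fun hX => ?_, fun hX Y hY => (commute_of_mem_Aq_of_mem_Bq hX hY).eq⟩
  obtain ⟨M, rfl⟩ := exists_vecMulLinear_eq X
  refine vecMulLinear_mem_adjoin (mem_adjoin_heckeGens_q fun G hG => ?_)
  have h := hX G.vecMulLinear (Algebra.subset_adjoin ⟨G, hG, rfl⟩)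
  rw [vecMulLinear_mul_vecMulLinear, vecMulLinear_mul_vecMulLinear] at h
  exact ((LinearMap.toMatrixRight' (R := 𝕂)).symm.injective h).symm
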